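/- arXiv:1307.6885 — 3 statements merged into one kernel-verified Lean document; each statement's English description precedes it below -/
import Mathlib

section
/- Let A ∈ ℂ^{n×n} be Hermitian, B ∈ ℂ^{n×n} be Hermitian positive definite, C = B⁻¹A, and let Q ∈ ℂ^{n×r} satisfy Q*BQ = I_r with P_B = QQ*B. If ‖(I − P_B)C‖_B ≤ ε for some ε ≥ 0, then ‖C − P_B C P_B‖_B ≤ 2ε. -/
open Matrix ComplexOrder

noncomputable section

/-- Euclidean (ℓ²) norm of a complex vector. -/
def vecNorm2 {m : Type*} [Fintype m] (x : m → ℂ) : ℝ :=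
  Real.sqrt (∑ i, ‖x i‖ ^ 2)

/-- Spectral (ℓ²-operator) norm of a complex matrix. -/
def specNorm {m p : Type*} [Fintype m] [Fintype p] (M : Matrix m p ℂ) : ℝ :=
  sSup {t : ℝ | ∃ x : p → ℂ, x ≠ 0 ∧ t = vecNorm2 (M *ᵥ x) / vecNorm2 x}

/-- The B-inner product ⟨x,y⟩_B = y*Bx. -/
def Binner {m : Type*} [Fintype m] (B : Matrix m m ℂ) (x y : m → ℂ) : ℂ :=
  star y ⬝ᵥ B *ᵥ x

/-- The B-norm of a vector, ‖x‖_B = √(x*Bx). -/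
def vecBnorm {m : Type*} [Fintype m] (B : Matrix m m ℂ) (x : m → ℂ) : ℝ :=
  Real.sqrt (star x ⬝ᵥ B *ᵥ x).re

/-- The induced B-norm of a matrix, ‖M‖_B = sup_{x ≠ 0} ‖Mx‖_B / ‖x‖_B. -/
def matBnorm {m : Type*} [Fintype m] (B M : Matrix m m ℂ) : ℝ :=
  sSup {t : ℝ | ∃ x : m → ℂ, x ≠ 0 ∧ t = vecBnorm B (M *ᵥ x) / vecBnorm B x}

section

open scoped MatrixOrder Matrix.Norms.L2Operator

/-- In a C⋆-ring, compressing a self-adjoint element `c` by a projection `p` changes it by at most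
twice the norm of the residual `(1 - p) * c`. -/
theorem IsStarProjection.norm_sub_compression_le {R : Type*} [NormedRing R] [StarRing R]
    [CStarRing R] {p c : R} (hp : IsStarProjection p) (hc : IsSelfAdjoint c) :
    ‖c - p * c * p‖ ≤ 2 * ‖(1 - p) * c‖ := by
  have hstar : star ((1 - p) * c) = c * (1 - p) := by
    simp [hc.star_eq, hp.isSelfAdjoint.star_eq]
  calc ‖c - p * c * p‖ = ‖(1 - p) * c + p * star ((1 - p) * c)‖ := by
        rw [hstar]; congr 1; noncomm_ring
    _ ≤ ‖(1 - p) * c‖ + ‖p‖ * ‖star ((1 - p) * c)‖ :=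
        (norm_add_le _ _).trans (by gcongr; exact norm_mul_le _ _)
    _ ≤ ‖(1 - p) * c‖ + 1 * ‖(1 - p) * c‖ := by
        rw [norm_star]; gcongr; exact hp.norm_le
    _ = 2 * ‖(1 - p) * c‖ := by ring

theorem vecBnorm_conjTranspose_mul_self {m : Type*} [Fintype m] (S : Matrix m m ℂ) (x : m → ℂ) :
    vecBnorm (Sᴴ * S) x = ‖WithLp.toLp 2 (S *ᵥ x)‖ := by
  have hdot : star x ⬝ᵥ (Sᴴ * S) *ᵥ x = (S *ᵥ x) ⬝ᵥ star (S *ᵥ x) := by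
    rw [← mulVec_mulVec, dotProduct_mulVec, ← star_mulVec, dotProduct_comm]
  rw [vecBnorm, hdot, @norm_eq_sqrt_re_inner ℂ, EuclideanSpace.inner_eq_star_dotProduct]
  rfl

theorem matBnorm_conjTranspose_mul_self {m : Type*} [Fintype m] [DecidableEq m]
    {S : Matrix m m ℂ} (hS : IsUnit S) (M : Matrix m m ℂ) :
    matBnorm (Sᴴ * S) M = ‖S * M * S⁻¹‖ := by
  have hdet : IsUnit S.det := (isUnit_iff_isUnit_det S).mp hS
  have hbound (x : m → ℂ) :
      vecBnorm (Sᴴ * S) (M *ᵥ x) ≤ ‖S * M * S⁻¹‖ * vecBnorm (Sᴴ * S) x := by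
    rw [vecBnorm_conjTranspose_mul_self, vecBnorm_conjTranspose_mul_self]
    convert l2_opNorm_mulVec (S * M * S⁻¹) (WithLp.toLp 2 (S *ᵥ x)) using 2
    simp [mulVec_mulVec, Matrix.mul_assoc, nonsing_inv_mul S hdet]
  have hle : ∀ t ∈ {t : ℝ | ∃ x : m → ℂ, x ≠ 0 ∧
      t = vecBnorm (Sᴴ * S) (M *ᵥ x) / vecBnorm (Sᴴ * S) x}, t ≤ ‖S * M * S⁻¹‖ := by
    rintro t ⟨x, -, rfl⟩
    exact div_le_of_le_mul₀ (Real.sqrt_nonneg _) (norm_nonneg _) (hbound x)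
  refine le_antisymm (Real.sSup_le hle (norm_nonneg _)) ?_
  rw [cstar_norm_def]
  refine ContinuousLinearMap.opNorm_le_bound _ (Real.sSup_nonneg ?_) fun y => ?_
  · rintro t ⟨x, -, rfl⟩
    exact div_nonneg (Real.sqrt_nonneg _) (Real.sqrt_nonneg _)
  obtain rfl | hy := eq_or_ne y 0
  · simp
  set x : m → ℂ := S⁻¹ *ᵥ y.ofLp with hx
  have hSx : S *ᵥ x = y.ofLp := by simp [hx, mulVec_mulVec, mul_nonsing_inv S hdet]
  have hx0 : x ≠ 0 := by
    intro h0
    rw [h0, mulVec_zero] at hSx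
    exact hy (by ext i; simp [← hSx])
  have hquot := le_csSup ⟨_, hle⟩ ⟨x, hx0, rfl⟩
  rw [vecBnorm_conjTranspose_mul_self, vecBnorm_conjTranspose_mul_self, hSx,
    div_le_iff₀ (norm_pos_iff.mpr hy)] at hquot
  rwa [show toEuclideanCLM (n := m) (𝕜 := ℂ) (S * M * S⁻¹) y = WithLp.toLp 2 (S *ᵥ (M *ᵥ x)) by
    rw [mulVec_mulVec, hx, mulVec_mulVec]; rfl]

theorem Matrix.PosDef.exists_isUnit_conjTranspose_mul_self {m : Type*} [Fintype m] [DecidableEq m]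
    {B : Matrix m m ℂ} (hB : B.PosDef) : ∃ S : Matrix m m ℂ, IsUnit S ∧ B = Sᴴ * S :=
  CStarAlgebra.isStrictlyPositive_iff_eq_star_mul_self.mp hB.isStrictlyPositive

/-- The case `B = Sᴴ * S`: the similarity `M ↦ S * M * S⁻¹` turns `B⁻¹ * A` into a Hermitian
matrix and the `B`-orthogonal projector into an orthogonal one. -/
theorem matBnorm_sub_compression_le {m k : Type*} [Fintype m] [DecidableEq m] [Fintype k]
    [DecidableEq k] {A B : Matrix m m ℂ} (hA : A.IsHermitian) (hB : B.PosDef)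
    {Q : Matrix m k ℂ} (hQ : Qᴴ * B * Q = 1) :
    matBnorm B (B⁻¹ * A - (Q * Qᴴ * B) * (B⁻¹ * A) * (Q * Qᴴ * B)) ≤
      2 * matBnorm B ((1 - Q * Qᴴ * B) * (B⁻¹ * A)) := by
  obtain ⟨S, hS, rfl⟩ := hB.exists_isUnit_conjTranspose_mul_self
  have hdet : IsUnit S.det := (isUnit_iff_isUnit_det S).mp hS
  have hl := nonsing_inv_mul S hdet
  have hr := mul_nonsing_inv S hdet
  rw [matBnorm_conjTranspose_mul_self hS, matBnorm_conjTranspose_mul_self hS]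
  set P := Q * Qᴴ * (Sᴴ * S) with hPdef
  set C := (Sᴴ * S)⁻¹ * A with hCdef
  have hmul (M N : Matrix m m ℂ) : S * (M * N) * S⁻¹ = S * M * S⁻¹ * (S * N * S⁻¹) := by
    simp only [Matrix.mul_assoc]
    rw [← Matrix.mul_assoc S⁻¹ S, hl, Matrix.one_mul]
  have hsub (M N : Matrix m m ℂ) : S * (M - N) * S⁻¹ = S * M * S⁻¹ - S * N * S⁻¹ := by
    rw [Matrix.mul_sub, Matrix.sub_mul]
  have hP : S * P * S⁻¹ = S * Q * (S * Q)ᴴ := by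
    simp only [hPdef, conjTranspose_mul, Matrix.mul_assoc, hr, Matrix.mul_one]
  have hC : S * C * S⁻¹ = (S⁻¹)ᴴ * A * S⁻¹ := by
    rw [hCdef, Matrix.mul_inv_rev, ← conjTranspose_nonsing_inv]
    simp only [← Matrix.mul_assoc, hr, Matrix.one_mul]
  have hproj : IsStarProjection (S * P * S⁻¹) := by
    rw [hP]
    refine ⟨?_, isHermitian_mul_conjTranspose_self _⟩
    have hone : (S * Q)ᴴ * (S * Q) = 1 := by
      rw [← hQ, conjTranspose_mul]; simp only [Matrix.mul_assoc]
    rw [IsIdempotentElem, Matrix.mul_assoc, ← Matrix.mul_assoc (S * Q)ᴴ, hone, Matrix.one_mul]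
  have hself : IsSelfAdjoint (S * C * S⁻¹) := by
    rw [hC]
    exact isHermitian_conjTranspose_mul_mul _ hA
  have hmain := hproj.norm_sub_compression_le hself
  rwa [hsub, hmul (P * C) P, hmul P C, hmul (1 - P) C, hsub, Matrix.mul_one, hr]

end

/-- if ‖(I − P_B)C‖_B ≤ ε then ‖C − P_B C P_B‖_B ≤ 2ε. -/
theorem statement5 {n r : ℕ} (A B : Matrix (Fin n) (Fin n) ℂ)
    (hA : A.IsHermitian) (hB : B.PosDef)
    (Q : Matrix (Fin n) (Fin r) ℂ) (hQ : Qᴴ * B * Q = 1)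
    (ε : ℝ) (hε : 0 ≤ ε)
    (h : matBnorm B ((1 - Q * Qᴴ * B) * (B⁻¹ * A)) ≤ ε) :
    matBnorm B ((B⁻¹ * A) - (Q * Qᴴ * B) * (B⁻¹ * A) * (Q * Qᴴ * B)) ≤ 2 * ε := by
  exact (matBnorm_sub_compression_le hA hB hQ).trans (by gcongr)
end
end

section
/- Let A ∈ ℝ^{n×n} be symmetric, B ∈ ℝ^{n×n} be symmetric positive definite, C = B⁻¹A, and let Q ∈ ℝ^{n×s} be a fixed matrix with QᵀBQ = I_s. Fix a positive integer r and a real number α > 1. Let ω₁, …, ω_r be independent random vectors in ℝⁿ, each with i.i.d. standard normal entries (law equal to the n-fold product of the standard Gaussian measure on ℝ). Then the event { ‖(I − QQᵀB)C‖_B ≤ α·√(2‖B⁻¹‖₂/π) · max_{1≤i≤r} ‖(I − QQᵀB)Cω_i‖_B } has probability at least 1 − α^{−r}. -/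
open Matrix MeasureTheory ProbabilityTheory

noncomputable section

/-- Euclidean (ℓ²) norm of a real vector. -/
def vecNorm2R {m : Type*} [Fintype m] (x : m → ℝ) : ℝ :=
  Real.sqrt (∑ i, x i ^ 2)

/-- Spectral (ℓ²-operator) norm of a real matrix. -/
def specNormR {m p : Type*} [Fintype m] [Fintype p] (M : Matrix m p ℝ) : ℝ :=
  sSup {t : ℝ | ∃ x : p → ℝ, x ≠ 0 ∧ t = vecNorm2R (M *ᵥ x) / vecNorm2R x}

/-- The B-inner product ⟨x,y⟩_B = yᵀBx. -/
def BinnerR {m : Type*} [Fintype m] (B : Matrix m m ℝ) (x y : m → ℝ) : ℝ :=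
  y ⬝ᵥ B *ᵥ x

/-- The B-norm of a real vector, ‖x‖_B = √(xᵀBx). -/
def vecBnormR {m : Type*} [Fintype m] (B : Matrix m m ℝ) (x : m → ℝ) : ℝ :=
  Real.sqrt (x ⬝ᵥ B *ᵥ x)

/-- The induced B-norm of a real matrix, ‖M‖_B = sup_{x ≠ 0} ‖Mx‖_B / ‖x‖_B. -/
def matBnormR {m : Type*} [Fintype m] (B M : Matrix m m ℝ) : ℝ :=
  sSup {t : ℝ | ∃ x : m → ℝ, x ≠ 0 ∧ t = vecBnormR B (M *ᵥ x) / vecBnormR B x}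

section Deterministic

variable {m : Type*} [Fintype m]

/-- The supremum of a quotient of continuous absolutely homogeneous functions on `m → ℝ` is
attained. -/
lemma exists_isGreatest_div_of_homogeneous [Nonempty m] {f g : (m → ℝ) → ℝ}
    (hf : Continuous f) (hg : Continuous g)
    (hfs : ∀ (c : ℝ) x, f (c • x) = |c| * f x) (hgs : ∀ (c : ℝ) x, g (c • x) = |c| * g x)
    (hg0 : ∀ x, x ≠ 0 → g x ≠ 0) :
    ∃ x, x ≠ 0 ∧ IsGreatest {t : ℝ | ∃ x : m → ℝ, x ≠ 0 ∧ t = f x / g x} (f x / g x) := by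
  have hne : (Metric.sphere (0 : m → ℝ) 1).Nonempty := NormedSpace.sphere_nonempty.2 zero_le_one
  have hne0 : ∀ x ∈ Metric.sphere (0 : m → ℝ) 1, x ≠ 0 := fun x hx ↦
    ne_zero_of_mem_unit_sphere (⟨x, hx⟩ : Metric.sphere (0 : m → ℝ) 1)
  obtain ⟨x, hx, hmax⟩ := (isCompact_sphere (0 : m → ℝ) 1).exists_isMaxOn hne
    (hf.continuousOn.div hg.continuousOn fun x hx ↦ hg0 x (hne0 x hx))
  refine ⟨x, hne0 x hx, ⟨x, hne0 x hx, rfl⟩, ?_⟩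
  rintro _ ⟨y, hy, rfl⟩
  have hy' : 0 < ‖y‖ := norm_pos_iff.2 hy
  have hmem : ‖y‖⁻¹ • y ∈ Metric.sphere (0 : m → ℝ) 1 := by
    simp [norm_smul, hy'.ne']
  have h := hmax hmem
  have hpos : |‖y‖⁻¹| ≠ 0 := by simpa using hy
  simpa only [Set.mem_ofPred_eq, Pi.div_apply, hfs, hgs, mul_div_mul_left _ _ hpos] using h

lemma vecNorm2R_eq_vecBnormR_one [DecidableEq m] (x : m → ℝ) :
    vecNorm2R x = vecBnormR 1 x := by
  simp [vecNorm2R, vecBnormR, dotProduct, sq]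

lemma vecBnormR_nonneg (B : Matrix m m ℝ) (x : m → ℝ) : 0 ≤ vecBnormR B x :=
  Real.sqrt_nonneg _

lemma continuous_vecBnormR (B : Matrix m m ℝ) : Continuous (vecBnormR B) := by
  unfold vecBnormR
  fun_prop

lemma vecBnormR_smul (B : Matrix m m ℝ) (c : ℝ) (x : m → ℝ) :
    vecBnormR B (c • x) = |c| * vecBnormR B x := by
  rw [vecBnormR, vecBnormR, mulVec_smul, smul_dotProduct, dotProduct_smul, smul_eq_mul,
    smul_eq_mul, ← mul_assoc, ← sq, Real.sqrt_mul (sq_nonneg c), Real.sqrt_sq_eq_abs]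

lemma vecBnormR_sq {B : Matrix m m ℝ} (hB : B.PosDef) (x : m → ℝ) :
    vecBnormR B x ^ 2 = x ⬝ᵥ B *ᵥ x :=
  Real.sq_sqrt (by simpa using hB.posSemidef.dotProduct_mulVec_nonneg x)

lemma vecBnormR_pos {B : Matrix m m ℝ} (hB : B.PosDef) {x : m → ℝ} (hx : x ≠ 0) :
    0 < vecBnormR B x :=
  Real.sqrt_pos.2 (by simpa using hB.dotProduct_mulVec_pos hx)

/-- Cauchy–Schwarz for the `B`-inner product. -/
lemma abs_dotProduct_mulVec_le_vecBnormR {B : Matrix m m ℝ} (hB : B.PosDef) (x y : m → ℝ) :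
    |x ⬝ᵥ B *ᵥ y| ≤ vecBnormR B x * vecBnormR B y := by
  classical
  have hsymm : Bᵀ = B := by simpa using hB.isHermitian.eq
  have h := LinearMap.BilinForm.apply_mul_apply_le_of_forall_zero_le (Matrix.toBilin' B)
    (fun x ↦ by simpa [Matrix.toBilin'_apply'] using hB.posSemidef.dotProduct_mulVec_nonneg x) x y
  simp only [Matrix.toBilin'_apply'] at h
  have hc : y ⬝ᵥ B *ᵥ x = x ⬝ᵥ B *ᵥ y := by
    rw [dotProduct_comm, ← vecMul_transpose, hsymm, dotProduct_mulVec]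
  rw [hc, ← vecBnormR_sq hB, ← vecBnormR_sq hB, ← mul_pow, ← sq] at h
  exact abs_le_of_sq_le_sq h (mul_nonneg (vecBnormR_nonneg B x) (vecBnormR_nonneg B y))

lemma vecNorm2R_mulVec_le [Nonempty m] (M : Matrix m m ℝ) (x : m → ℝ) :
    vecNorm2R (M *ᵥ x) ≤ specNormR M * vecNorm2R x := by
  classical
  have hg0 : ∀ x : m → ℝ, x ≠ 0 → 0 < vecNorm2R x := fun x hx ↦ by
    rw [vecNorm2R_eq_vecBnormR_one]
    exact vecBnormR_pos Matrix.PosDef.one hx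
  have hc : Continuous (vecNorm2R : (m → ℝ) → ℝ) := by
    unfold vecNorm2R
    fun_prop
  have hs : ∀ (c : ℝ) (x : m → ℝ), vecNorm2R (c • x) = |c| * vecNorm2R x := fun c x ↦ by
    simp only [vecNorm2R_eq_vecBnormR_one, vecBnormR_smul]
  obtain ⟨z, -, hz⟩ := exists_isGreatest_div_of_homogeneous
    (f := fun x ↦ vecNorm2R (M *ᵥ x)) (g := vecNorm2R) (by fun_prop) hc
    (fun c x ↦ by rw [mulVec_smul, hs]) hs (fun x hx ↦ (hg0 x hx).ne')
  rcases eq_or_ne x 0 with rfl | hx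
  · simp [vecNorm2R]
  · rw [← div_le_iff₀ (hg0 x hx)]
    exact le_csSup ⟨_, hz.2⟩ ⟨x, hx, rfl⟩

lemma vecBnormR_inv_mulVec_le [Nonempty m] [DecidableEq m] {B : Matrix m m ℝ} (hB : B.PosDef)
    (w : m → ℝ) :
    vecBnormR B (B⁻¹ *ᵥ w) ≤ √(specNormR B⁻¹) * vecNorm2R w := by
  have hw : 0 ≤ vecNorm2R w := Real.sqrt_nonneg _
  have hdet : IsUnit B.det := (Matrix.isUnit_iff_isUnit_det B).1 hB.isUnit
  rw [vecBnormR, ← Real.sqrt_sq hw, ← Real.sqrt_mul' _ (sq_nonneg _)]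
  apply Real.sqrt_le_sqrt
  rw [mulVec_mulVec, mul_nonsing_inv _ hdet, one_mulVec]
  have h := abs_dotProduct_mulVec_le_vecBnormR (Matrix.PosDef.one (n := m) (R := ℝ)) (B⁻¹ *ᵥ w) w
  rw [one_mulVec, ← vecNorm2R_eq_vecBnormR_one, ← vecNorm2R_eq_vecBnormR_one] at h
  nlinarith [le_abs_self (B⁻¹ *ᵥ w ⬝ᵥ w), vecNorm2R_mulVec_le B⁻¹ w]

/-- A linear functional minorizing `‖M ·‖_B` whose Euclidean norm controls `‖M‖_B`. -/
lemma exists_dotProduct_le_vecBnormR [Nonempty m] [DecidableEq m] {B : Matrix m m ℝ}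
    (hB : B.PosDef) (M : Matrix m m ℝ) :
    ∃ w : m → ℝ, (∀ x, |w ⬝ᵥ x| ≤ vecBnormR B (M *ᵥ x)) ∧
      matBnormR B M ≤ √(specNormR B⁻¹) * vecNorm2R w := by
  have hdet : IsUnit B.det := (Matrix.isUnit_iff_isUnit_det B).1 hB.isUnit
  obtain ⟨x, hx, hmax⟩ := exists_isGreatest_div_of_homogeneous
    (f := fun x ↦ vecBnormR B (M *ᵥ x)) (g := vecBnormR B)
    ((continuous_vecBnormR B).comp (by fun_prop)) (continuous_vecBnormR B)
    (fun c x ↦ by rw [mulVec_smul, vecBnormR_smul]) (vecBnormR_smul B)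
    (fun x hx ↦ (vecBnormR_pos hB hx).ne')
  set y := M *ᵥ x with hy
  set w := (vecBnormR B y)⁻¹ • (Mᵀ *ᵥ B *ᵥ y) with hw
  have hwz : ∀ z, w ⬝ᵥ z = (vecBnormR B y)⁻¹ * ((M *ᵥ z) ⬝ᵥ B *ᵥ y) := fun z ↦ by
    rw [hw, smul_dotProduct, smul_eq_mul, mulVec_transpose, ← dotProduct_mulVec, dotProduct_comm]
  refine ⟨w, fun z ↦ ?_, ?_⟩
  · rw [hwz, abs_mul, abs_of_nonneg (inv_nonneg.2 (vecBnormR_nonneg B y))]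
    rcases (vecBnormR_nonneg B y).eq_or_lt with h0 | h0
    · simpa [← h0] using vecBnormR_nonneg B _
    · rw [inv_mul_le_iff₀ h0, mul_comm]
      exact abs_dotProduct_mulVec_le_vecBnormR hB _ _
  · rw [matBnormR, hmax.csSup_eq, div_le_iff₀ (vecBnormR_pos hB hx)]
    have h1 : vecBnormR B y = w ⬝ᵥ x := by
      rw [hwz, ← hy, ← vecBnormR_sq hB, sq, ← mul_assoc, inv_mul_mul_self]
    have h2 := abs_dotProduct_mulVec_le_vecBnormR hB x (B⁻¹ *ᵥ w)
    rw [mulVec_mulVec, mul_nonsing_inv _ hdet, one_mulVec, dotProduct_comm, ← h1] at h2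
    calc vecBnormR B y ≤ vecBnormR B x * vecBnormR B (B⁻¹ *ᵥ w) := (le_abs_self _).trans h2
      _ ≤ vecBnormR B x * (√(specNormR B⁻¹) * vecNorm2R w) :=
          mul_le_mul_of_nonneg_left (vecBnormR_inv_mulVec_le hB w) (vecBnormR_nonneg B x)
      _ = _ := mul_comm _ _

end Deterministic

section Probability

open scoped NNReal

lemma gaussianReal_abs_lt_le {v : ℝ≥0} (hv : v ≠ 0) (t : ℝ) :
    gaussianReal 0 v {x | |x| < t} ≤ ENNReal.ofReal (2 * t / √(2 * Real.pi * v)) := by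
  rw [gaussianReal_apply _ hv]
  have hs : {x : ℝ | |x| < t} = Set.Ioo (-t) t := by
    ext x
    simp [abs_lt]
  calc ∫⁻ x in {x : ℝ | |x| < t}, gaussianPDF 0 v x
      ≤ ∫⁻ _ in {x : ℝ | |x| < t}, ENNReal.ofReal (√(2 * Real.pi * v))⁻¹ := by
        refine lintegral_mono fun x ↦ ENNReal.ofReal_le_ofReal ?_
        rw [gaussianPDFReal]
        refine mul_le_of_le_one_right (by positivity) (Real.exp_le_one_iff.2 ?_)
        exact div_nonpos_of_nonpos_of_nonneg (by simpa using sq_nonneg _) (by positivity)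
    _ = ENNReal.ofReal (2 * t / √(2 * Real.pi * v)) := by
        rw [setLIntegral_const, hs, Real.volume_Ioo, ← ENNReal.ofReal_mul (by positivity)]
        congr 1
        ring

lemma map_dotProduct_pi_gaussianReal {m : Type*} [Fintype m] (w : m → ℝ) :
    (Measure.pi fun _ : m ↦ gaussianReal 0 1).map (fun x ↦ w ⬝ᵥ x)
      = gaussianReal 0 (∑ i, w i ^ 2).toNNReal := by
  have hvar : Var[fun x ↦ w ⬝ᵥ x; Measure.pi fun _ : m ↦ gaussianReal 0 1] = ∑ i, w i ^ 2 := by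
    have h := variance_sum_pi (μ := fun _ : m ↦ gaussianReal 0 1) (X := fun i x ↦ w i * x)
      (fun i ↦ (memLp_id_gaussianReal 2).const_mul (w i))
    convert h using 1
    · congr 1
      ext x
      simp [dotProduct]
    · refine Finset.sum_congr rfl fun i _ ↦ ?_
      rw [variance_const_mul, variance_fun_id_gaussianReal]
      simp
  have hlaw : HasGaussianLaw (fun x : m → ℝ ↦ w ⬝ᵥ x)
      (Measure.pi fun _ : m ↦ gaussianReal 0 1) := by
    have hi : ∀ i, HasGaussianLaw (fun x : m → ℝ ↦ x i)
        (Measure.pi fun _ : m ↦ gaussianReal 0 1) := fun i ↦ ⟨by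
      rw [(measurePreserving_eval (fun _ : m ↦ gaussianReal 0 1) i).map_eq]
      infer_instance⟩
    have hind : iIndepFun (fun i (x : m → ℝ) ↦ x i)
        (Measure.pi fun _ : m ↦ gaussianReal 0 1) :=
      iIndepFun_pi (X := fun _ ↦ id) fun _ ↦ aemeasurable_id
    exact (hind.hasGaussianLaw hi).map (LinearMap.toContinuousLinearMap
      (dotProductBilin ℝ ℝ w))
  have hmean : ∫ x, w ⬝ᵥ x ∂(Measure.pi fun _ : m ↦ gaussianReal 0 1) = 0 := by
    simp only [dotProduct]
    rw [integral_finsetSum]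
    · refine Finset.sum_eq_zero fun i _ ↦ ?_
      rw [integral_const_mul, integral_comp_eval (μ := fun _ : m ↦ gaussianReal 0 1)
        (f := fun y ↦ y) aestronglyMeasurable_id, integral_id_gaussianReal, mul_zero]
    · exact fun i _ ↦ (integrable_comp_eval (μ := fun _ : m ↦ gaussianReal 0 1)
        ((memLp_id_gaussianReal 1).integrable le_rfl)).const_mul (w i)
  rw [hlaw.map_eq_gaussianReal, hvar, hmean]

lemma pi_gaussianReal_abs_dotProduct_lt_le {m : Type*} [Fintype m] {w : m → ℝ}
    (hw : 0 < vecNorm2R w) (t : ℝ) :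
    (Measure.pi fun _ : m ↦ gaussianReal 0 1) {x | |w ⬝ᵥ x| < t}
      ≤ ENNReal.ofReal (2 * t / (√(2 * Real.pi) * vecNorm2R w)) := by
  have hpos : 0 < ∑ i, w i ^ 2 := Real.sqrt_pos.1 hw
  have h := gaussianReal_abs_lt_le (v := (∑ i, w i ^ 2).toNNReal) (by simpa using hpos) t
  rw [Real.coe_toNNReal _ hpos.le, Real.sqrt_mul (by positivity),
    ← map_dotProduct_pi_gaussianReal, Measure.map_apply (by fun_prop)
      (measurableSet_lt (by fun_prop) (by fun_prop))] at h
  exact h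

end Probability

/-- a posteriori randomized error bound.  With ω₁,…,ω_r i.i.d. standard
    Gaussian vectors in ℝⁿ, the event
    ‖(I − QQᵀB)C‖_B ≤ α √(2‖B⁻¹‖₂/π) max_i ‖(I − QQᵀB)Cω_i‖_B
    has probability at least 1 − α^{−r}. -/
theorem statement9 {n s : ℕ} (A B : Matrix (Fin n) (Fin n) ℝ)
    (hA : A.IsSymm) (hB : B.PosDef)
    (Q : Matrix (Fin n) (Fin s) ℝ) (hQ : Qᵀ * B * Q = 1)
    (r : ℕ) (hr : 0 < r) (α : ℝ) (hα : 1 < α) :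
    1 - (α ^ r)⁻¹ ≤
      ((Measure.pi fun _ : Fin r => Measure.pi fun _ : Fin n => gaussianReal 0 1)
        {ω : Fin r → Fin n → ℝ |
          matBnormR B ((1 - Q * Qᵀ * B) * (B⁻¹ * A)) ≤
            α * Real.sqrt (2 * specNormR B⁻¹ / Real.pi) *
              ⨆ i : Fin r,
                vecBnormR B (((1 - Q * Qᵀ * B) * (B⁻¹ * A)) *ᵥ ω i)}).toReal := by
  set M := (1 - Q * Qᵀ * B) * (B⁻¹ * A)
  set E := {ω : Fin r → Fin n → ℝ | matBnormR B M ≤ α * √(2 * specNormR B⁻¹ / Real.pi) *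
    ⨆ i : Fin r, vecBnormR B (M *ᵥ ω i)} with hE
  set μ := Measure.pi fun _ : Fin r ↦ Measure.pi fun _ : Fin n ↦ gaussianReal 0 1
  have hα0 : 0 < α := one_pos.trans hα
  have hprob : μ Eᶜ ≤ ENNReal.ofReal (α ^ r)⁻¹ := by
    rcases le_or_gt (matBnormR B M) 0 with h0 | h0
    · have : E = Set.univ := Set.eq_univ_of_forall fun ω ↦ h0.trans <|
        mul_nonneg (by positivity) (Real.iSup_nonneg fun i ↦ vecBnormR_nonneg B _)
      simp [this]
    have : Nonempty (Fin n) := by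
      by_contra hn
      rw [not_nonempty_iff] at hn
      have hempty : {t : ℝ | ∃ x : Fin n → ℝ, x ≠ 0 ∧
          t = vecBnormR B (M *ᵥ x) / vecBnormR B x} = ∅ :=
        Set.eq_empty_of_forall_notMem fun t ⟨x, hx, _⟩ ↦ hx (Subsingleton.elim _ _)
      simp [matBnormR, hempty] at h0
    obtain ⟨w, hw, hσ⟩ := exists_dotProduct_le_vecBnormR hB M
    have hpos := h0.trans_le hσ
    have hw0 : 0 < vecNorm2R w := pos_of_mul_pos_right hpos (Real.sqrt_nonneg _)
    have hb : 0 < √(specNormR B⁻¹) := pos_of_mul_pos_left hpos hw0.le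
    have hsqrt : √(2 * specNormR B⁻¹ / Real.pi) * √(2 * Real.pi) = 2 * √(specNormR B⁻¹) := by
      rw [← Real.sqrt_mul' _ (by positivity)]
      have : 2 * specNormR B⁻¹ / Real.pi * (2 * Real.pi) = 2 ^ 2 * specNormR B⁻¹ := by
        field_simp
      rw [this, Real.sqrt_mul (by positivity), Real.sqrt_sq (by norm_num)]
    have hκ : 0 < √(2 * specNormR B⁻¹ / Real.pi) :=
      pos_of_mul_pos_left (hsqrt.symm ▸ mul_pos two_pos hb) (Real.sqrt_nonneg _)
    set t := matBnormR B M / (α * √(2 * specNormR B⁻¹ / Real.pi)) with ht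
    have hsub : Eᶜ ⊆ Set.univ.pi fun _ ↦ {x | |w ⬝ᵥ x| < t} := by
      intro ω hω i _
      simp only [hE, Set.mem_compl_iff, Set.mem_ofPred_eq, not_le] at hω
      rw [Set.mem_ofPred_eq, ht, lt_div_iff₀' (by positivity)]
      refine lt_of_le_of_lt (mul_le_mul_of_nonneg_left ?_ (by positivity)) hω
      exact (hw _).trans
        (le_ciSup (f := fun i ↦ vecBnormR B (M *ᵥ ω i)) (Set.finite_range _).bddAbove i)
    have hbound : 2 * t / (√(2 * Real.pi) * vecNorm2R w) ≤ α⁻¹ := by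
      have h1 : 2 * t / (√(2 * Real.pi) * vecNorm2R w) = α⁻¹ * (2 * matBnormR B M /
          (√(2 * specNormR B⁻¹ / Real.pi) * √(2 * Real.pi) * vecNorm2R w)) := by
        rw [ht]
        field_simp
      rw [h1, hsqrt]
      refine mul_le_of_le_one_right (by positivity) ((div_le_one (by positivity)).2 ?_)
      linarith
    calc μ Eᶜ ≤ μ (Set.univ.pi fun _ ↦ {x | |w ⬝ᵥ x| < t}) := measure_mono hsub
      _ ≤ ∏ _ : Fin r, ENNReal.ofReal α⁻¹ := by
          rw [Measure.pi_pi]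
          exact Finset.prod_le_prod' fun _ _ ↦
            (pi_gaussianReal_abs_dotProduct_lt_le hw0 t).trans
              (ENNReal.ofReal_le_ofReal hbound)
      _ = ENNReal.ofReal (α ^ r)⁻¹ := by
          rw [Finset.prod_const, Finset.card_univ, Fintype.card_fin,
            ← ENNReal.ofReal_pow (by positivity), inv_pow]
  have hone : (1 : ℝ) ≤ μ.real E + μ.real Eᶜ := by
    simpa using measureReal_union_le (μ := μ) E Eᶜ
  have hcompl : μ.real Eᶜ ≤ (α ^ r)⁻¹ := ENNReal.toReal_le_of_le_ofReal (by positivity) hprob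
  change _ ≤ μ.real E
  linarith
end
end

section
/- Let A ∈ ℝ^{n×n} be symmetric, B ∈ ℝ^{n×n} be symmetric positive definite, and C = B⁻¹A. Let σ_{B,1} ≥ σ_{B,2} ≥ … ≥ σ_{B,n} ≥ 0 be the generalized singular values of C, i.e., the singular values of B^{1/2}C arranged in decreasing order, where B^{1/2} is the positive definite square root of B. Fix integers k ≥ 2 and p ≥ 2 with k + p ≤ n. Let Ω be an n × (k+p) random matrix with i.i.d. standard normal entries, and for each realization of Ω let P_B(Ω) denote the B-orthogonal projector of ℝⁿ onto the column space of CΩ (the projector that is orthogonal with respect to the B-inner product). Then E[ ‖(I − P_B(Ω))C‖_B ] ≤ √‖B⁻¹‖₂ · [ (1 + √(k/(p−1)))·σ_{B,k+1} + (e√(k+p)/p)·( Σ_{j=k+1}^{n} σ_{B,j}² )^{1/2} ], where E denotes expectation with respect to the Gaussian distribution of Ω and e is Euler's number. -/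
open Matrix MeasureTheory ProbabilityTheory

noncomputable section

/-- The half-line moments `∫₀^∞ r ^ j exp (-r² / 2) dr`. -/
def halfMoment (j : ℕ) : ℝ := ∫ r in Set.Ioi (0 : ℝ), r ^ j * Real.exp (-(1 / 2) * r ^ 2)

lemma integrableOn_halfMoment (j : ℕ) :
    IntegrableOn (fun r : ℝ => r ^ j * Real.exp (-(1 / 2) * r ^ 2)) (Set.Ioi 0) := by
  have h := integrableOn_rpow_mul_exp_neg_mul_sq (b := 1 / 2) (by norm_num) (s := j)
    (by have : (0 : ℝ) ≤ j := j.cast_nonneg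
        linarith)
  simpa only [Real.rpow_natCast] using h

lemma halfMoment_eq (j : ℕ) :
    halfMoment j =
      (1 / 2 : ℝ) ^ (-(j + 1) / 2 : ℝ) * (1 / 2) * Real.Gamma ((j + 1) / 2) := by
  have h := integral_rpow_mul_exp_neg_mul_rpow (p := 2) (q := j) (b := 1 / 2) (by norm_num)
    (by have : (0 : ℝ) ≤ j := j.cast_nonneg
        linarith) (by norm_num)
  rw [← h, halfMoment]
  refine integral_congr_ae (Filter.Eventually.of_forall fun x => ?_)
  simp

lemma halfMoment_pos (j : ℕ) : 0 < halfMoment j := by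
  rw [halfMoment_eq]
  have := Real.Gamma_pos_of_pos (s := ((j : ℝ) + 1) / 2) (by positivity)
  positivity

lemma halfMoment_add_two (j : ℕ) : halfMoment (j + 2) = (j + 1) * halfMoment j := by
  rw [halfMoment_eq, halfMoment_eq]
  have h1 : (((j + 2 : ℕ) : ℝ) + 1) / 2 = ((j : ℝ) + 1) / 2 + 1 := by push_cast; ring
  have h2 : (-(((j + 2 : ℕ) : ℝ) + 1) / 2) = -((j : ℝ) + 1) / 2 - 1 := by push_cast; ring
  rw [h1, h2, Real.Gamma_add_one (by positivity), Real.rpow_sub_one (by norm_num)]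
  ring

lemma halfMoment_zero : halfMoment 0 = √(Real.pi / 2) := by
  have h := integral_gaussian_Ioi (1 / 2)
  have h2 : halfMoment 0 = √(Real.pi / (1 / 2)) / 2 := by
    rw [← h, halfMoment]; simp
  rw [h2, show Real.pi / (1 / 2) = 2 ^ 2 * (Real.pi / 2) by ring, Real.sqrt_mul (by positivity),
    Real.sqrt_sq (by norm_num)]
  ring

lemma halfMoment_one : halfMoment 1 = 1 := by
  rw [halfMoment_eq]
  norm_num [Real.Gamma_one, Real.rpow_neg_one]

lemma halfMoment_succ_le (j : ℕ) : halfMoment (j + 1) ≤ √(j + 1) * halfMoment j := by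
  set c : ℝ := √(j + 1) with hc
  have hc0 : 0 < c := by positivity
  have hcc : c ^ 2 = j + 1 := Real.sq_sqrt (by positivity)
  have h : halfMoment (j + 1) ≤ (c / 2) * halfMoment j + (1 / (2 * c)) * halfMoment (j + 2) := by
    unfold halfMoment
    rw [← integral_const_mul, ← integral_const_mul, ← integral_add
      ((integrableOn_halfMoment j).const_mul _) ((integrableOn_halfMoment (j + 2)).const_mul _)]
    refine setIntegral_mono_on (integrableOn_halfMoment _)
      (((integrableOn_halfMoment j).const_mul _).add
        ((integrableOn_halfMoment (j + 2)).const_mul _)) measurableSet_Ioi fun r hr => ?_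
    have hr : 0 < r := hr
    have : r ≤ c / 2 + 1 / (2 * c) * r ^ 2 := by
      have h3 : c / 2 + 1 / (2 * c) * r ^ 2 - r = (c - r) ^ 2 / (2 * c) := by field_simp; ring
      have : 0 ≤ (c - r) ^ 2 / (2 * c) := by positivity
      linarith
    calc r ^ (j + 1) * Real.exp (-(1 / 2) * r ^ 2)
        = r * (r ^ j * Real.exp (-(1 / 2) * r ^ 2)) := by ring
      _ ≤ (c / 2 + 1 / (2 * c) * r ^ 2) * (r ^ j * Real.exp (-(1 / 2) * r ^ 2)) := by gcongr
      _ = _ := by ring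
  rw [halfMoment_add_two, ← hcc] at h
  refine h.trans (le_of_eq ?_)
  field_simp
  ring

lemma halfMoment_mul_succ (j : ℕ) :
    halfMoment j * halfMoment (j + 1) = √(Real.pi / 2) * j.factorial := by
  induction j with
  | zero => simp [halfMoment_zero, halfMoment_one]
  | succ j ih =>
    rw [halfMoment_add_two, Nat.factorial_succ]
    push_cast
    linear_combination ((j : ℝ) + 1) * ih

/-- Stirling-type lower bound for the absolute moments of a standard Gaussian. -/
lemma le_halfMoment_ratio_sq (p : ℕ) (hp : 1 ≤ p) :
    (p / Real.exp 1) ^ p ≤ (halfMoment p / halfMoment 0) ^ 2 := by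
  have h1 := halfMoment_succ_le p
  have h2 := halfMoment_mul_succ p
  have h3 := Stirling.le_factorial_stirling p
  have hpos := halfMoment_pos p
  have hp' : (1 : ℝ) ≤ p := by exact_mod_cast hp
  have h4 : √(Real.pi / 2) * p.factorial ≤ √(p + 1) * halfMoment p ^ 2 := by
    rw [← h2]; nlinarith
  set a : ℝ := (p / Real.exp 1) ^ p
  have ha : 0 < a := by positivity
  have h5 : √(Real.pi / 2) * (√(2 * Real.pi * p) * a) ≤ √(p + 1) * halfMoment p ^ 2 :=
    (mul_le_mul_of_nonneg_left h3 (by positivity)).trans h4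
  have h6 : √(Real.pi / 2) * √(2 * Real.pi * p) = Real.pi * √p := by
    rw [← Real.sqrt_mul (by positivity), show Real.pi / 2 * (2 * Real.pi * p) = Real.pi ^ 2 * p by ring,
      Real.sqrt_mul (by positivity), Real.sqrt_sq Real.pi_pos.le]
  have h7 : √((p : ℝ) + 1) ≤ 2 * √p := by
    rw [Real.sqrt_le_left (by positivity), mul_pow, Real.sq_sqrt (by positivity)]; linarith
  have hsp : 0 < √(p : ℝ) := by positivity
  have h8 : Real.pi * √p * a ≤ 2 * √p * halfMoment p ^ 2 := by
    calc _ = √(Real.pi / 2) * (√(2 * Real.pi * p) * a) := by rw [← h6]; ring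
      _ ≤ _ := h5
      _ ≤ _ := by gcongr
  have h9 : Real.pi * a ≤ 2 * halfMoment p ^ 2 := by
    by_contra! hcon
    nlinarith
  rw [div_pow, halfMoment_zero, Real.sq_sqrt (by positivity), le_div_iff₀ (by positivity)]
  linarith

lemma halfMoment_add_le (d m : ℕ) :
    halfMoment (d + m) ≤ √((d : ℝ) + m) ^ m * halfMoment d := by
  have key : ∀ (c : ℝ) (m : ℕ), (d : ℝ) + m ≤ c →
      halfMoment (d + m) ≤ √c ^ m * halfMoment d := by
    intro c m
    induction m with
    | zero => intro _; simp
    | succ m ih =>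
      intro hc
      push_cast at hc
      calc halfMoment (d + (m + 1)) ≤ √((d + m : ℕ) + 1) * halfMoment (d + m) :=
            halfMoment_succ_le (d + m)
        _ ≤ √c * (√c ^ m * halfMoment d) :=
             mul_le_mul (Real.sqrt_le_sqrt (by push_cast; linarith)) (ih (by linarith))
              (halfMoment_pos _).le (Real.sqrt_nonneg _)
        _ = _ := by ring
  exact key _ m le_rfl

section Polar

variable {E : Type*} [NormedAddCommGroup E] [InnerProductSpace ℝ E] [FiniteDimensional ℝ E]
  [MeasurableSpace E] [BorelSpace E]

/-- The density of the standard Gaussian measure of a Euclidean space. -/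
lemma stdGaussian_eq_withDensity :
    ∃ C : ℝ, 0 < C ∧ stdGaussian E =
      volume.withDensity fun x : E => ENNReal.ofReal (C * Real.exp (-(1 / 2) * ‖x‖ ^ 2)) := by
  set C : ℝ := (2 * Real.pi) ^ (-(Module.finrank ℝ E : ℝ) / 2) with hC
  have hC0 : 0 < C := by positivity
  have hmeas : Measurable fun x : E => ENNReal.ofReal (C * Real.exp (-(1 / 2) * ‖x‖ ^ 2)) := by
    fun_prop
  have hint : ∀ t : E, ∫ x : E, Complex.exp (-(1 / 2 : ℂ) * ‖x‖ ^ 2 + Complex.I * (inner ℝ t x : ℝ))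
      = (C : ℂ)⁻¹ * Complex.exp (-‖t‖ ^ 2 / 2) := by
    intro t
    rw [GaussianFourier.integral_cexp_neg_mul_sq_norm_add (b := 1 / 2) (by norm_num)]
    congr 1
    · rw [hC, Complex.ofReal_cpow (by positivity), ← Complex.cpow_neg]
      push_cast
      congr 1 <;> ring
    · congr 1
      simp
      ring
  refine ⟨C, hC0, ?_⟩
  have hfin : ∫⁻ x : E, ENNReal.ofReal (C * Real.exp (-(1 / 2) * ‖x‖ ^ 2)) ≠ ⊤ := by
    have h0 := hint 0
    have hne : ∫ x : E, Complex.exp (-(1 / 2 : ℂ) * ‖x‖ ^ 2 + Complex.I * (inner ℝ (0 : E) x : ℝ)) ≠ 0 := by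
      rw [h0]
      simp [hC0.ne']
    have hi : Integrable fun x : E =>
        Complex.exp (-(1 / 2 : ℂ) * ‖x‖ ^ 2 + Complex.I * (inner ℝ (0 : E) x : ℝ)) := by
      by_contra hcon
      exact hne (integral_undef hcon)
    have hi2 : Integrable fun x : E => C * Real.exp (-(1 / 2) * ‖x‖ ^ 2) := by
      refine (hi.norm.const_mul C).congr (Filter.Eventually.of_forall fun x => ?_)
      simp only [inner_zero_left, Complex.norm_exp]
      congr 2
      simp [← Complex.ofReal_pow]
    exact hi2.lintegral_lt_top.ne
  have : IsFiniteMeasure (volume.withDensity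
      fun x : E => ENNReal.ofReal (C * Real.exp (-(1 / 2) * ‖x‖ ^ 2))) :=
    isFiniteMeasure_withDensity hfin
  apply Measure.ext_of_charFun
  ext t
  rw [charFun_stdGaussian, charFun_apply, integral_withDensity_eq_integral_toReal_smul hmeas
    (Filter.Eventually.of_forall fun x => ENNReal.ofReal_lt_top)]
  have : ∀ x : E, (ENNReal.ofReal (C * Real.exp (-(1 / 2) * ‖x‖ ^ 2))).toReal •
      Complex.exp ((inner ℝ x t : ℝ) * Complex.I) =
      C * Complex.exp (-(1 / 2 : ℂ) * ‖x‖ ^ 2 + Complex.I * (inner ℝ t x : ℝ)) := by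
    intro x
    rw [ENNReal.toReal_ofReal (by positivity), Complex.exp_add, real_inner_comm, Complex.real_smul]
    push_cast
    rw [mul_comm Complex.I]
    ring
  simp_rw [this]
  rw [integral_const_mul, hint, ← mul_assoc, mul_inv_cancel₀ (by exact_mod_cast hC0.ne'), one_mul]

/-- Radial integrals against the standard Gaussian measure. -/
lemma lintegral_norm_stdGaussian {d : ℕ} (hd : Module.finrank ℝ E = d + 1) {f : ℝ → ℝ}
    (hf : Measurable f) (hf0 : ∀ r, 0 ≤ r → 0 ≤ f r)
    (hint : IntegrableOn (fun r => r ^ d * f r * Real.exp (-(1 / 2) * r ^ 2)) (Set.Ioi 0)) :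
    ∫⁻ x, ENNReal.ofReal (f ‖x‖) ∂(stdGaussian E) = ENNReal.ofReal
      ((∫ r in Set.Ioi (0 : ℝ), r ^ d * f r * Real.exp (-(1 / 2) * r ^ 2)) / halfMoment d) := by
  have : Nontrivial E := Module.nontrivial_of_finrank_pos (R := ℝ) (by omega)
  obtain ⟨C, hC, hE⟩ := stdGaussian_eq_withDensity (E := E)
  have hd' : Module.finrank ℝ E - 1 = d := by omega
  set K : ℝ := (d + 1) * (volume : Measure E).real (Metric.ball 0 1) with hK
  have main : ∀ g : ℝ → ℝ, Measurable g → (∀ r, 0 ≤ r → 0 ≤ g r) →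
      IntegrableOn (fun r => r ^ d * g r * Real.exp (-(1 / 2) * r ^ 2)) (Set.Ioi 0) →
      ∫⁻ x, ENNReal.ofReal (g ‖x‖) ∂(stdGaussian E) = ENNReal.ofReal
        (C * K * ∫ r in Set.Ioi (0 : ℝ), r ^ d * g r * Real.exp (-(1 / 2) * r ^ 2)) := by
    intro g hg hg0 hgi
    set G : ℝ → ℝ := fun r => C * Real.exp (-(1 / 2) * r ^ 2) * g r
    have hGi : Integrable (fun x : E => G ‖x‖) := by
      refine (integrable_fun_norm_addHaar (volume : Measure E) (f := G)).2 ?_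
      rw [hd']
      refine (hgi.const_mul C).congr (Filter.Eventually.of_forall fun r => ?_)
      simp only [G, smul_eq_mul]; ring
    have h1 : ∫⁻ x, ENNReal.ofReal (g ‖x‖) ∂(stdGaussian E) = ∫⁻ x : E, ENNReal.ofReal (G ‖x‖) := by
      rw [hE, lintegral_withDensity_eq_lintegral_mul _ (by fun_prop) (by fun_prop)]
      refine lintegral_congr fun x => ?_
      rw [Pi.mul_apply, ← ENNReal.ofReal_mul (by positivity)]
    rw [h1, ← ofReal_integral_eq_lintegral_ofReal hGi (Filter.Eventually.of_forall fun x => ?_)]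
    · congr 1
      have hG : ∫ y in Set.Ioi (0 : ℝ), y ^ d • G y =
          C * ∫ r in Set.Ioi (0 : ℝ), r ^ d * g r * Real.exp (-(1 / 2) * r ^ 2) := by
        rw [← integral_const_mul]
        refine integral_congr_ae (Filter.Eventually.of_forall fun r => ?_)
        simp only [G, smul_eq_mul]
        ring
      rw [integral_fun_norm_addHaar, hd', hd, hK, hG]
      simp only [nsmul_eq_mul, smul_eq_mul]
      push_cast
      ring
    · have := hg0 ‖x‖ (norm_nonneg x)
      simp only [G, Pi.zero_apply]; positivity
  have h1 := main (fun _ => 1) (by fun_prop) (by simp)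
    (by simpa using integrableOn_halfMoment d)
  simp only [ENNReal.ofReal_one, lintegral_const, measure_univ, mul_one] at h1
  have h2 : C * K * halfMoment d = 1 := by
    have := h1.symm
    rw [ENNReal.ofReal_eq_one] at this
    exact this
  rw [main f hf hf0 hint]
  congr 1
  rw [eq_div_iff (halfMoment_pos d).ne']
  linear_combination (∫ r in Set.Ioi (0 : ℝ), r ^ d * f r * Real.exp (-(1 / 2) * r ^ 2)) * h2

lemma lintegral_norm_pow_stdGaussian {d : ℕ} (hd : Module.finrank ℝ E = d + 1) (m : ℕ) :
    ∫⁻ x, ENNReal.ofReal (‖x‖ ^ m) ∂(stdGaussian E) =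
      ENNReal.ofReal (halfMoment (d + m) / halfMoment d) := by
  have he : (fun r : ℝ => r ^ d * r ^ m * Real.exp (-(1 / 2) * r ^ 2)) =
      fun r => r ^ (d + m) * Real.exp (-(1 / 2) * r ^ 2) := by
    ext r; rw [pow_add]
  rw [lintegral_norm_stdGaussian hd (f := fun r => r ^ m) (by fun_prop)
    (fun r hr => by positivity) (by rw [he]; exact integrableOn_halfMoment _), he]
  rfl

lemma lintegral_norm_inv_pow_stdGaussian {d : ℕ} (hd : Module.finrank ℝ E = d + 1) {m : ℕ}
    (hm : m ≤ d) :
    ∫⁻ x, ENNReal.ofReal (‖x‖⁻¹ ^ m) ∂(stdGaussian E) =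
      ENNReal.ofReal (halfMoment (d - m) / halfMoment d) := by
  have he : Set.EqOn (fun r : ℝ => r ^ d * r⁻¹ ^ m * Real.exp (-(1 / 2) * r ^ 2))
      (fun r => r ^ (d - m) * Real.exp (-(1 / 2) * r ^ 2)) (Set.Ioi 0) := by
    intro r hr
    have hr : r ≠ 0 := ne_of_gt hr
    simp only
    rw [pow_sub₀ _ hr hm, inv_pow]
  rw [lintegral_norm_stdGaussian hd (f := fun r => r⁻¹ ^ m) (by fun_prop)
    (fun r hr => by positivity)
    ((integrableOn_halfMoment _).congr_fun he.symm measurableSet_Ioi),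
    setIntegral_congr_fun measurableSet_Ioi he]
  rfl

end Polar

section GaussianIBP

variable {E : Type*} [NormedAddCommGroup E] [InnerProductSpace ℝ E] [FiniteDimensional ℝ E]
  [MeasurableSpace E] [BorelSpace E]

/-- Gaussian integration by parts. -/
lemma integral_inner_mul_stdGaussian {f : E → ℝ} {f' : E → E →L[ℝ] ℝ}
    (hf : ∀ x, HasFDerivAt f (f' x) x) (u : E) {M M' : ℝ} (hM : ∀ x, |f x| ≤ M)
    (hM' : ∀ x, |f' x u| ≤ M') :
    ∫ x, inner ℝ u x * f x ∂(stdGaussian E) = ∫ x, f' x u ∂(stdGaussian E) := by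
  obtain ⟨C, hC, hE⟩ := stdGaussian_eq_withDensity (E := E)
  set ρ : E → ℝ := fun x => C * Real.exp (-(1 / 2) * ‖x‖ ^ 2) with hρ
  have hρm : Measurable fun x : E => ENNReal.ofReal (ρ x) := by fun_prop
  have hρ0 : ∀ x, 0 ≤ ρ x := fun x => by positivity
  have hfc : Continuous f := continuous_iff_continuousAt.2 fun x => (hf x).continuousAt
  have hf'u : (fun x => f' x u) = fun x => fderiv ℝ f x u := by
    ext x; rw [(hf x).fderiv]
  have hf'm : Measurable fun x => f' x u := by
    rw [hf'u]; exact measurable_fderiv_apply_const ℝ f u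
  have hρd : ∀ x, HasFDerivAt ρ (-(ρ x) • innerSL ℝ x) x := by
    intro x
    have h := (((hasStrictFDerivAt_norm_sq x).hasFDerivAt.const_mul (-(1 / 2) : ℝ)).exp).const_mul C
    refine h.congr_fderiv ?_
    ext v
    simp [ρ]
    ring
  have hnorm : Integrable (fun x : E => ‖x‖) (stdGaussian E) := IsGaussian.integrable_id.norm
  have hconv : ∀ g : E → ℝ, ∫ x, g x ∂(stdGaussian E) = ∫ x, ρ x * g x := by
    intro g
    rw [hE, integral_withDensity_eq_integral_toReal_smul hρm
      (Filter.Eventually.of_forall fun x => ENNReal.ofReal_lt_top)]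
    simp_rw [ENNReal.toReal_ofReal (hρ0 _), smul_eq_mul]
  have hconvi : ∀ g : E → ℝ, Integrable g (stdGaussian E) → Integrable fun x => ρ x * g x := by
    intro g hg
    rw [hE, integrable_withDensity_iff_integrable_smul' hρm
      (Filter.Eventually.of_forall fun x => ENNReal.ofReal_lt_top)] at hg
    simpa only [ENNReal.toReal_ofReal (hρ0 _), smul_eq_mul] using hg
  have hi1 : Integrable (fun x => f' x u) (stdGaussian E) :=
    Integrable.of_bound hf'm.aestronglyMeasurable M' (Filter.Eventually.of_forall hM')
  have hi2 : Integrable f (stdGaussian E) :=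
    Integrable.of_bound hfc.aestronglyMeasurable M (Filter.Eventually.of_forall hM)
  have hi3 : Integrable (fun x => inner ℝ u x * f x) (stdGaussian E) := by
    refine (hnorm.const_mul (‖u‖ * M)).mono' (by fun_prop) (Filter.Eventually.of_forall fun x => ?_)
    rw [norm_mul]
    calc ‖inner ℝ u x‖ * ‖f x‖ ≤ (‖u‖ * ‖x‖) * M :=
          mul_le_mul (norm_inner_le_norm u x) (hM x) (norm_nonneg _) (by positivity)
      _ = _ := by ring
  have hfd : ∀ x, fderiv ℝ f x = f' x := fun x => (hf x).fderiv
  have hρfd : ∀ x, fderiv ℝ ρ x = -(ρ x) • innerSL ℝ x := fun x => (hρd x).fderiv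
  have key := integral_mul_fderiv_eq_neg_fderiv_mul_of_integrable (μ := (volume : Measure E))
    (f := f) (g := ρ) (v := u)
    (by simp only [hfd]; simpa only [mul_comm] using hconvi _ hi1)
    (by
      simp only [hρfd]
      refine (hconvi _ hi3).neg.congr (Filter.Eventually.of_forall fun x => ?_)
      simp [real_inner_comm]; ring)
    (by simpa only [mul_comm] using hconvi _ hi2)
    (fun x _ => (hf x).differentiableAt) (fun x _ => (hρd x).differentiableAt)
  simp only [hfd, hρfd] at key
  rw [hconv, hconv, ← neg_inj, ← integral_neg]
  simp_rw [mul_comm (ρ _) (f' _ _)]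
  rw [← key]
  refine integral_congr_ae (Filter.Eventually.of_forall fun x => ?_)
  simp [real_inner_comm]; ring

end GaussianIBP

section Softmax

variable {E : Type*} [NormedAddCommGroup E] [InnerProductSpace ℝ E] {T : Type*} [Fintype T]

/-- The log-sum-exp function of a finite family of linear functionals. -/
def logSumExp (c : T → E) (x : E) : ℝ := Real.log (∑ t, Real.exp (inner ℝ (c t) x))

/-- The softmax weights of a finite family of linear functionals. -/
def softmax (c : T → E) (t : T) (x : E) : ℝ :=
  Real.exp (inner ℝ (c t) x) / ∑ s, Real.exp (inner ℝ (c s) x)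

lemma softmax_nonneg (c : T → E) (t : T) (x : E) : 0 ≤ softmax c t x := by
  unfold softmax; positivity

variable [Nonempty T]

lemma sum_exp_inner_pos (c : T → E) (x : E) : 0 < ∑ t, Real.exp (inner ℝ (c t) x) :=
  Finset.sum_pos (fun _ _ => Real.exp_pos _) Finset.univ_nonempty

lemma sum_softmax (c : T → E) (x : E) : ∑ t, softmax c t x = 1 := by
  unfold softmax
  rw [← Finset.sum_div, div_self (sum_exp_inner_pos c x).ne']

lemma softmax_le_one (c : T → E) (t : T) (x : E) : softmax c t x ≤ 1 := by
  rw [← sum_softmax c x]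
  exact Finset.single_le_sum (fun s _ => softmax_nonneg c s x) (Finset.mem_univ t)

lemma hasFDerivAt_softmax (c : T → E) (t : T) (x : E) :
    HasFDerivAt (softmax c t)
      (softmax c t x • (innerSL ℝ (c t) - ∑ s, softmax c s x • innerSL ℝ (c s))) x := by
  have h1 : ∀ s, HasFDerivAt (fun y => Real.exp (inner ℝ (c s) y))
      (Real.exp (inner ℝ (c s) x) • innerSL ℝ (c s)) x := fun s =>
    ((innerSL ℝ (c s)).hasFDerivAt (x := x)).exp
  have h2 := HasFDerivAt.fun_sum fun s (_ : s ∈ Finset.univ) => h1 s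
  have hpos := (sum_exp_inner_pos c x).ne'
  refine ((h1 t).mul ((hasDerivAt_inv hpos).comp_hasFDerivAt x h2)).congr_fderiv ?_
  ext v
  simp only [softmax, _root_.smul_apply, _root_.sub_apply, _root_.add_apply, Function.comp_apply,
    _root_.sum_apply, innerSL_apply_apply, smul_eq_mul, div_mul_eq_mul_div, ← Finset.sum_div]
  field_simp
  ring

lemma inner_le_logSumExp (c : T → E) (x : E) (t : T) : inner ℝ (c t) x ≤ logSumExp c x := by
  rw [logSumExp, Real.le_log_iff_exp_le (sum_exp_inner_pos c x)]
  exact Finset.single_le_sum (f := fun s => Real.exp (inner ℝ (c s) x))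
    (fun s _ => (Real.exp_pos _).le) (Finset.mem_univ t)

lemma logSumExp_le (c : T → E) (x : E) {M : ℝ} (hM : ∀ t, inner ℝ (c t) x ≤ M) :
    logSumExp c x ≤ M + Real.log (Fintype.card T) := by
  rw [logSumExp, Real.log_le_iff_le_exp (sum_exp_inner_pos c x), Real.exp_add,
    Real.exp_log (by exact_mod_cast Fintype.card_pos)]
  calc ∑ t, Real.exp (inner ℝ (c t) x) ≤ ∑ _t : T, Real.exp M :=
        Finset.sum_le_sum fun t _ => Real.exp_le_exp.2 (hM t)
    _ = _ := by simp [mul_comm]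

lemma continuous_logSumExp (c : T → E) : Continuous (logSumExp c) :=
  Continuous.log (by fun_prop) fun x => (sum_exp_inner_pos c x).ne'

lemma continuous_softmax (c : T → E) (t : T) : Continuous (softmax c t) :=
  Continuous.div (by fun_prop) (by fun_prop) fun x => (sum_exp_inner_pos c x).ne'

lemma abs_logSumExp_le (c : T → E) (x : E) :
    |logSumExp c x| ≤ (∑ t, ‖c t‖) * ‖x‖ + Real.log (Fintype.card T) := by
  have h : ∀ t, |inner ℝ (c t) x| ≤ (∑ t, ‖c t‖) * ‖x‖ := fun t =>
    (abs_real_inner_le_norm _ _).trans <| by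
      gcongr
      exact Finset.single_le_sum (f := fun s => ‖c s‖) (fun s _ => norm_nonneg _)
        (Finset.mem_univ t)
  have hlog : 0 ≤ Real.log (Fintype.card T) := Real.log_natCast_nonneg _
  obtain ⟨t⟩ := ‹Nonempty T›
  have := (abs_le.1 (h t)).1
  exact abs_le.2 ⟨by linarith [inner_le_logSumExp c x t],
    logSumExp_le c x fun t => (abs_le.1 (h t)).2⟩

/-- Derivative of the log-sum-exp function along a path of families. -/
lemma hasDerivAt_logSumExp {c : ℝ → T → E} {c' : T → E} {θ : ℝ}
    (hc : ∀ t, HasDerivAt (fun τ => c τ t) (c' t) θ) (x : E) :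
    HasDerivAt (fun τ => logSumExp (c τ) x) (∑ t, softmax (c θ) t x * inner ℝ (c' t) x) θ := by
  have h1 : ∀ t, HasDerivAt (fun τ => Real.exp (inner ℝ (c τ t) x))
      (Real.exp (inner ℝ (c θ t) x) * inner ℝ (c' t) x) θ := fun t => by
    have := ((hc t).inner ℝ (hasDerivAt_const θ x)).exp
    simpa using this
  have h2 := (HasDerivAt.fun_sum fun t (_ : t ∈ Finset.univ) => h1 t).log
    (sum_exp_inner_pos (c θ) x).ne'
  refine h2.congr_deriv ?_
  simp only [softmax, div_mul_eq_mul_div, ← Finset.sum_div]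

end Softmax

section SudakovFernique

variable {E : Type*} [NormedAddCommGroup E] [InnerProductSpace ℝ E] [FiniteDimensional ℝ E]
  [MeasurableSpace E] [BorelSpace E] {T : Type*} [Fintype T] [Nonempty T]

lemma integrable_logSumExp (c : T → E) : Integrable (logSumExp c) (stdGaussian E) := by
  have hnorm : Integrable (fun x : E => ‖x‖) (stdGaussian E) := IsGaussian.integrable_id.norm
  exact ((hnorm.const_mul (∑ t, ‖c t‖)).add (integrable_const (Real.log (Fintype.card T)))).mono'
    (continuous_logSumExp c).aestronglyMeasurable
    (Filter.Eventually.of_forall fun x => abs_logSumExp_le c x)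

lemma integrable_softmax (c : T → E) (t : T) : Integrable (softmax c t) (stdGaussian E) :=
  Integrable.of_bound (continuous_softmax c t).aestronglyMeasurable 1
    (Filter.Eventually.of_forall fun x => by
      rw [Real.norm_eq_abs, abs_of_nonneg (softmax_nonneg c t x)]; exact softmax_le_one c t x)

lemma integrable_softmax_mul (c : T → E) (s t : T) :
    Integrable (fun x => softmax c s x * softmax c t x) (stdGaussian E) :=
  Integrable.of_bound
    ((continuous_softmax c s).mul (continuous_softmax c t)).aestronglyMeasurable 1
    (Filter.Eventually.of_forall fun x => by
      rw [Real.norm_eq_abs,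
        abs_of_nonneg (mul_nonneg (softmax_nonneg c s x) (softmax_nonneg c t x))]
      exact mul_le_one₀ (softmax_le_one c s x) (softmax_nonneg c t x) (softmax_le_one c t x))

lemma integral_inner_mul_softmax (c : T → E) (t : T) (u : E) :
    ∫ x, inner ℝ u x * softmax c t x ∂(stdGaussian E) =
      inner ℝ (c t) u * ∫ x, softmax c t x ∂(stdGaussian E) -
        ∑ s, inner ℝ (c s) u * ∫ x, softmax c t x * softmax c s x ∂(stdGaussian E) := by
  have happ : ∀ x, (softmax c t x • (innerSL ℝ (c t) - ∑ s, softmax c s x • innerSL ℝ (c s))) u =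
      inner ℝ (c t) u * softmax c t x - ∑ s, inner ℝ (c s) u * (softmax c t x * softmax c s x) := by
    intro x
    simp only [_root_.smul_apply, _root_.sub_apply,
      _root_.sum_apply, innerSL_apply_apply, smul_eq_mul, mul_sub, Finset.mul_sum]
    congr 1
    · ring
    · exact Finset.sum_congr rfl fun s _ => by ring
  rw [integral_inner_mul_stdGaussian (hasFDerivAt_softmax c t) u (M := 1)
    (M' := |inner ℝ (c t) u| + ∑ s, |inner ℝ (c s) u|)]
  · simp_rw [happ]
    rw [integral_sub ((integrable_softmax c t).const_mul _)
      (integrable_finsetSum _ fun s _ => (integrable_softmax_mul c t s).const_mul _),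
      integral_const_mul, integral_finsetSum _ fun s _ => (integrable_softmax_mul c t s).const_mul _]
    simp_rw [integral_const_mul]
  · intro x
    rw [abs_of_nonneg (softmax_nonneg c t x)]; exact softmax_le_one c t x
  · intro x
    have h1 : ∀ a p : ℝ, 0 ≤ p → p ≤ 1 → |a * p| ≤ |a| := fun a p h0 h1 => by
      rw [abs_mul, abs_of_nonneg h0]; exact mul_le_of_le_one_right (abs_nonneg a) h1
    rw [happ]
    refine (abs_sub _ _).trans (add_le_add (h1 _ _ (softmax_nonneg c t x) (softmax_le_one c t x))
      ((Finset.abs_sum_le_sum_abs _ _).trans (Finset.sum_le_sum fun s _ => h1 _ _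
        (mul_nonneg (softmax_nonneg c t x) (softmax_nonneg c s x)) ?_)))
    exact mul_le_one₀ (softmax_le_one c t x) (softmax_nonneg c s x) (softmax_le_one c s x)

/-- The derivative of `E logSumExp` along a path, through increments of the family. -/
lemma sum_integral_softmax_mul_inner (c c' : T → E) :
    ∑ t, ∫ x, inner ℝ (c' t) x * softmax c t x ∂(stdGaussian E) =
      ∑ t, ∑ s, (1 / 2) * inner ℝ (c t - c s) (c' t - c' s) *
        ∫ x, softmax c t x * softmax c s x ∂(stdGaussian E) := by
  set q : T → T → ℝ := fun t s => ∫ x, softmax c t x * softmax c s x ∂(stdGaussian E) with hq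
  have hqs : ∀ t s, q t s = q s t := fun t s => by simp only [hq, mul_comm]
  have hqt : ∀ t, ∫ x, softmax c t x ∂(stdGaussian E) = ∑ s, q t s := by
    intro t
    rw [← integral_finsetSum _ fun s _ => integrable_softmax_mul c t s]
    simp_rw [← Finset.mul_sum, sum_softmax, mul_one]
  have h1 : ∑ t, ∫ x, inner ℝ (c' t) x * softmax c t x ∂(stdGaussian E) =
      ∑ t, ∑ s, (inner ℝ (c t) (c' t) - inner ℝ (c s) (c' t)) * q t s := by
    refine Finset.sum_congr rfl fun t _ => ?_
    rw [integral_inner_mul_softmax, hqt, Finset.mul_sum, ← Finset.sum_sub_distrib]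
    exact Finset.sum_congr rfl fun s _ => by ring
  have h2 : ∑ t, ∑ s, (inner ℝ (c t) (c' t) - inner ℝ (c s) (c' t)) * q t s =
      ∑ t, ∑ s, (inner ℝ (c s) (c' s) - inner ℝ (c t) (c' s)) * q t s := by
    rw [Finset.sum_comm]
    exact Finset.sum_congr rfl fun t _ => Finset.sum_congr rfl fun s _ => by rw [hqs]
  have h3 : ∀ a b : ℝ, a = b → a = (1 / 2) * a + (1 / 2) * b := fun a b h => by rw [h]; ring
  rw [h1, h3 _ _ h2, Finset.mul_sum, Finset.mul_sum, ← Finset.sum_add_distrib]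
  refine Finset.sum_congr rfl fun t _ => ?_
  rw [Finset.mul_sum, Finset.mul_sum, ← Finset.sum_add_distrib]
  refine Finset.sum_congr rfl fun s _ => ?_
  rw [inner_sub_left, inner_sub_right, inner_sub_right]
  ring

/-- Sudakov-Fernique comparison for log-sum-exp, for two orthogonal families. -/
lemma integral_logSumExp_le {a b : T → E} (hab : ∀ s t, inner ℝ (a s) (b t) = 0)
    (hinc : ∀ s t, ‖a s - a t‖ ≤ ‖b s - b t‖) :
    ∫ x, logSumExp a x ∂(stdGaussian E) ≤ ∫ x, logSumExp b x ∂(stdGaussian E) := by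
  set c : ℝ → T → E := fun θ t => Real.cos θ • a t + Real.sin θ • b t with hc
  set c' : ℝ → T → E := fun θ t => -Real.sin θ • a t + Real.cos θ • b t with hc'
  have hcd : ∀ θ t, HasDerivAt (fun τ => c τ t) (c' θ t) θ := fun θ t =>
    ((Real.hasDerivAt_cos θ).smul_const (a t)).add ((Real.hasDerivAt_sin θ).smul_const (b t))
  have hc'b : ∀ θ t, ‖c' θ t‖ ≤ ‖a t‖ + ‖b t‖ := fun θ t => by
    refine (norm_add_le _ _).trans ?_
    rw [norm_smul, norm_smul, norm_neg]
    exact add_le_add (mul_le_of_le_one_left (norm_nonneg _) (Real.abs_sin_le_one θ))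
      (mul_le_of_le_one_left (norm_nonneg _) (Real.abs_cos_le_one θ))
  have hnorm : Integrable (fun x : E => ‖x‖) (stdGaussian E) := IsGaussian.integrable_id.norm
  have hterm : ∀ θ t x, ‖softmax (c θ) t x * inner ℝ (c' θ t) x‖ ≤ (‖a t‖ + ‖b t‖) * ‖x‖ := by
    intro θ t x
    rw [norm_mul, Real.norm_of_nonneg (softmax_nonneg _ _ _)]
    calc softmax (c θ) t x * ‖inner ℝ (c' θ t) x‖ ≤ 1 * (‖c' θ t‖ * ‖x‖) :=
          mul_le_mul (softmax_le_one _ _ _) (norm_inner_le_norm _ _) (norm_nonneg _) zero_le_one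
      _ ≤ _ := by rw [one_mul]; gcongr; exact hc'b θ t
  have hterm_int : ∀ θ t, Integrable (fun x => softmax (c θ) t x * inner ℝ (c' θ t) x)
      (stdGaussian E) := fun θ t =>
    (hnorm.const_mul (‖a t‖ + ‖b t‖)).mono'
      ((continuous_softmax _ _).mul (by fun_prop)).aestronglyMeasurable
      (Filter.Eventually.of_forall (hterm θ t))
  have hφ : ∀ θ, HasDerivAt (fun τ => ∫ x, logSumExp (c τ) x ∂(stdGaussian E))
      (∫ x, ∑ t, softmax (c θ) t x * inner ℝ (c' θ t) x ∂(stdGaussian E)) θ := by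
    intro θ
    refine (hasDerivAt_integral_of_dominated_loc_of_deriv_le
      (F' := fun τ x => ∑ t, softmax (c τ) t x * inner ℝ (c' τ t) x)
      (bound := fun x => ∑ t, (‖a t‖ + ‖b t‖) * ‖x‖) (Filter.univ_mem)
      (Filter.Eventually.of_forall fun τ => (continuous_logSumExp _).aestronglyMeasurable)
      (integrable_logSumExp _) ?_ ?_ ?_ ?_).2
    · exact (integrable_finsetSum _ fun t _ => hterm_int θ t).aestronglyMeasurable
    · exact Filter.Eventually.of_forall fun x τ _ =>
        (norm_sum_le _ _).trans (Finset.sum_le_sum fun t _ => hterm τ t x)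
    · exact integrable_finsetSum _ fun t _ => hnorm.const_mul _
    · exact Filter.Eventually.of_forall fun x τ _ => hasDerivAt_logSumExp (hcd τ) x
  have hinner : ∀ θ s t, inner ℝ (c θ t - c θ s) (c' θ t - c' θ s) =
      Real.sin θ * Real.cos θ * (‖b t - b s‖ ^ 2 - ‖a t - a s‖ ^ 2) := by
    intro θ s t
    have h0 : inner ℝ (a t - a s) (b t - b s) = 0 := by
      simp [inner_sub_left, inner_sub_right, hab]
    have h1 : c θ t - c θ s = Real.cos θ • (a t - a s) + Real.sin θ • (b t - b s) := by
      simp only [hc, smul_sub]; abel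
    have h2 : c' θ t - c' θ s = -Real.sin θ • (a t - a s) + Real.cos θ • (b t - b s) := by
      simp only [hc', smul_sub]; abel
    rw [h1, h2]
    simp only [inner_add_left, inner_add_right, real_inner_smul_left, real_inner_smul_right,
      real_inner_comm (a t - a s) (b t - b s), h0, real_inner_self_eq_norm_sq]
    ring
  have hmono : MonotoneOn (fun τ => ∫ x, logSumExp (c τ) x ∂(stdGaussian E))
      (Set.Icc 0 (Real.pi / 2)) := by
    refine monotoneOn_of_hasDerivWithinAt_nonneg (convex_Icc _ _)
      (fun θ _ => (hφ θ).continuousAt.continuousWithinAt)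
      (fun θ _ => (hφ θ).hasDerivWithinAt) fun θ hθ => ?_
    rw [interior_Icc] at hθ
    have hs : 0 ≤ Real.sin θ :=
      Real.sin_nonneg_of_nonneg_of_le_pi hθ.1.le (by linarith [hθ.2, Real.pi_pos])
    have hcos : 0 ≤ Real.cos θ :=
      Real.cos_nonneg_of_neg_pi_div_two_le_of_le (by linarith [hθ.1, Real.pi_pos]) hθ.2.le
    rw [integral_finsetSum _ fun t _ => hterm_int θ t]
    simp_rw [mul_comm (softmax _ _ _)]
    rw [sum_integral_softmax_mul_inner]
    refine Finset.sum_nonneg fun t _ => Finset.sum_nonneg fun s _ => ?_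
    rw [hinner]
    have h1 : 0 ≤ ‖b t - b s‖ ^ 2 - ‖a t - a s‖ ^ 2 :=
      sub_nonneg.2 (pow_le_pow_left₀ (norm_nonneg _) (hinc t s) 2)
    have h2 : 0 ≤ ∫ x, softmax (c θ) t x * softmax (c θ) s x ∂(stdGaussian E) :=
      integral_nonneg fun x => mul_nonneg (softmax_nonneg _ _ _) (softmax_nonneg _ _ _)
    positivity
  have h := hmono (Set.left_mem_Icc.2 (by positivity)) (Set.right_mem_Icc.2 (by positivity))
    (by positivity : (0 : ℝ) ≤ Real.pi / 2)
  simpa [hc] using h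

lemma integrable_iSup_inner (a : T → E) :
    Integrable (fun x => ⨆ t, inner ℝ (a t) x) (stdGaussian E) := by
  have hnorm : Integrable (fun x : E => ‖x‖) (stdGaussian E) := IsGaussian.integrable_id.norm
  have hM : ∀ x t, |inner ℝ (a t) x| ≤ (∑ t, ‖a t‖) * ‖x‖ := fun x t =>
    (abs_real_inner_le_norm _ _).trans <| by
      gcongr
      exact Finset.single_le_sum (f := fun s => ‖a s‖) (fun s _ => norm_nonneg _)
        (Finset.mem_univ t)
  refine (hnorm.const_mul (∑ t, ‖a t‖)).mono'
    (Measurable.iSup fun t => by fun_prop).aestronglyMeasurable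
    (Filter.Eventually.of_forall fun x => ?_)
  obtain ⟨t⟩ := ‹Nonempty T›
  exact abs_le.2 ⟨(abs_le.1 (hM x t)).1.trans
    (le_ciSup (f := fun t => inner ℝ (a t) x) (Set.finite_range _).bddAbove t),
    have : Nonempty T := ⟨t⟩
    ciSup_le fun t => (abs_le.1 (hM x t)).2⟩

/-- Sudakov-Fernique comparison inequality, for two orthogonal families. -/
theorem integral_iSup_inner_le {a b : T → E} (hab : ∀ s t, inner ℝ (a s) (b t) = 0)
    (hinc : ∀ s t, ‖a s - a t‖ ≤ ‖b s - b t‖) :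
    ∫ x, ⨆ t, inner ℝ (a t) x ∂(stdGaussian E) ≤
      ∫ x, ⨆ t, inner ℝ (b t) x ∂(stdGaussian E) := by
  set L : ℝ := Real.log (Fintype.card T)
  have hβ : ∀ β : ℝ, 0 < β → ∫ x, ⨆ t, inner ℝ (a t) x ∂(stdGaussian E) ≤
      ∫ x, ⨆ t, inner ℝ (b t) x ∂(stdGaussian E) + L / β := by
    intro β hβ
    have h1 : β * ∫ x, ⨆ t, inner ℝ (a t) x ∂(stdGaussian E) ≤
        ∫ x, logSumExp (fun t => β • a t) x ∂(stdGaussian E) := by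
      rw [← integral_const_mul]
      refine integral_mono ((integrable_iSup_inner a).const_mul β) (integrable_logSumExp _)
        fun x => ?_
      have h : (⨆ t, inner ℝ (a t) x) ≤ logSumExp (fun t => β • a t) x / β := ciSup_le fun t => by
        rw [le_div_iff₀ hβ, mul_comm, ← real_inner_smul_left]
        exact inner_le_logSumExp (fun t => β • a t) x t
      rw [le_div_iff₀ hβ] at h
      simp only
      linarith
    have h2 : ∫ x, logSumExp (fun t => β • b t) x ∂(stdGaussian E) ≤
        β * ∫ x, ⨆ t, inner ℝ (b t) x ∂(stdGaussian E) + L := by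
      have : ∫ x, (β * (⨆ t, inner ℝ (b t) x) + L) ∂(stdGaussian E) =
          β * ∫ x, ⨆ t, inner ℝ (b t) x ∂(stdGaussian E) + L := by
        rw [integral_add ((integrable_iSup_inner b).const_mul β) (integrable_const _),
          integral_const_mul]
        simp
      rw [← this]
      refine integral_mono (integrable_logSumExp _)
        (((integrable_iSup_inner b).const_mul β).add (integrable_const _)) fun x => ?_
      refine logSumExp_le _ x fun t => ?_
      rw [real_inner_smul_left]
      exact mul_le_mul_of_nonneg_left
        (le_ciSup (f := fun t => inner ℝ (b t) x) (Set.finite_range _).bddAbove t) hβ.le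
    have h3 := integral_logSumExp_le (a := fun t => β • a t) (b := fun t => β • b t)
      (fun s t => by rw [real_inner_smul_left, real_inner_smul_right, hab]; simp)
      (fun s t => by
        rw [← smul_sub, ← smul_sub, norm_smul, norm_smul]
        exact mul_le_mul_of_nonneg_left (hinc s t) (norm_nonneg _))
    have h4 := h1.trans (h3.trans h2)
    rw [← sub_le_iff_le_add', le_div_iff₀ hβ]
    linarith
  refine le_of_forall_pos_le_add fun ε hε => ?_
  have hL : 0 ≤ L := Real.log_natCast_nonneg _
  have h := hβ ((L + 1) / ε) (by positivity)
  have : L / ((L + 1) / ε) ≤ ε := by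
    rw [div_div_eq_mul_div, div_le_iff₀ (by positivity)]
    nlinarith
  linarith

end SudakovFernique

/-- The law of a vector with independent standard Gaussian entries. -/
abbrev gaussVec (ι : Type*) [Fintype ι] : Measure (ι → ℝ) :=
  Measure.pi fun _ : ι => gaussianReal 0 1

/-- The law of a matrix with independent standard Gaussian entries. -/
abbrev gaussMat (κ ν : Type*) [Fintype κ] [Fintype ν] : Measure (κ → ν → ℝ) :=
  Measure.pi fun _ : κ => gaussVec ν

lemma map_stdGaussian_of_inner {E F : Type*} [NormedAddCommGroup E] [InnerProductSpace ℝ E]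
    [FiniteDimensional ℝ E] [MeasurableSpace E] [BorelSpace E] [NormedAddCommGroup F]
    [InnerProductSpace ℝ F] [FiniteDimensional ℝ F] [MeasurableSpace F] [BorelSpace F]
    {L : E → F} (hL : Measurable L) {J : F → E} (hJ : ∀ t, ‖J t‖ = ‖t‖)
    (h : ∀ x t, inner ℝ (L x) t = inner ℝ x (J t)) :
    (stdGaussian E).map L = stdGaussian F := by
  have := Measure.isProbabilityMeasure_map (μ := stdGaussian E) hL.aemeasurable
  apply Measure.ext_of_charFun
  ext t
  rw [charFun_stdGaussian, ← hJ, ← charFun_stdGaussian (E := E), charFun_apply, charFun_apply,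
    integral_map hL.aemeasurable (Measurable.aestronglyMeasurable (by fun_prop))]
  simp_rw [h]

lemma map_toLp_gaussVec (ι : Type*) [Fintype ι] :
    (gaussVec ι).map (WithLp.toLp 2) = stdGaussian (EuclideanSpace ℝ ι) :=
  map_pi_eq_stdGaussian

lemma map_ofLp_stdGaussian (ι : Type*) [Fintype ι] :
    (stdGaussian (EuclideanSpace ℝ ι)).map WithLp.ofLp = gaussVec ι := by
  rw [← map_toLp_gaussVec, Measure.map_map (by fun_prop) (by fun_prop)]
  exact Measure.map_id

section

variable {κ ν : Type*} [Fintype κ] [Fintype ν]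

lemma map_curry_stdGaussian :
    (stdGaussian (EuclideanSpace ℝ (κ × ν))).map (fun x i j => x (i, j)) = gaussMat κ ν := by
  have h := Measure.infinitePi_map_curry (ι := κ) (κ := ν) (fun _ _ => gaussianReal 0 1)
  simp only [Measure.infinitePi_eq_pi] at h
  rw [gaussMat, ← h, ← gaussVec, ← map_ofLp_stdGaussian, Measure.map_map (by fun_prop) (by fun_prop)]
  rfl

end

section Moments

variable {E : Type*} [NormedAddCommGroup E] [InnerProductSpace ℝ E] [FiniteDimensional ℝ E]
  [MeasurableSpace E] [BorelSpace E]

lemma integrable_inner_sq_stdGaussian (w : E) :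
    Integrable (fun x => inner ℝ w x ^ 2) (stdGaussian E) :=
  (IsGaussian.memLp_dual (stdGaussian E) (innerSL ℝ w) 2 (by norm_num)).integrable_sq

lemma integral_inner_sq_stdGaussian (w : E) :
    ∫ x, inner ℝ w x ^ 2 ∂(stdGaussian E) = ‖w‖ ^ 2 := by
  have h := variance_dual_stdGaussian (innerSL ℝ w)
  rw [variance_eq_sub (IsGaussian.memLp_dual (stdGaussian E) _ 2 (by norm_num)),
    integral_strongDual_stdGaussian, innerSL_apply_norm] at h
  simpa using h

lemma integrable_sqrt_sum_inner_sq {ι : Type*} [Fintype ι] (w : ι → E) :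
    Integrable (fun x => √(∑ i, inner ℝ (w i) x ^ 2)) (stdGaussian E) := by
  refine ((integrable_finsetSum Finset.univ fun i _ => integrable_inner_sq_stdGaussian (w i)).add
    (integrable_const 1)).mono' (by fun_prop) (Filter.Eventually.of_forall fun x => ?_)
  rw [Real.norm_of_nonneg (Real.sqrt_nonneg _)]
  have h0 : 0 ≤ ∑ i, inner ℝ (w i) x ^ 2 := Finset.sum_nonneg fun i _ => sq_nonneg _
  exact Real.sqrt_le_iff.2 ⟨by simp only [Pi.add_apply]; linarith,
    by simp only [Pi.add_apply]; nlinarith⟩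

lemma integral_sqrt_sum_inner_sq_le {ι : Type*} [Fintype ι] (w : ι → E) :
    ∫ x, √(∑ i, inner ℝ (w i) x ^ 2) ∂(stdGaussian E) ≤ √(∑ i, ‖w i‖ ^ 2) := by
  set X : E → ℝ := fun x => √(∑ i, inner ℝ (w i) x ^ 2)
  have hsq : ∀ x, X x ^ 2 = ∑ i, inner ℝ (w i) x ^ 2 := fun x =>
    Real.sq_sqrt (Finset.sum_nonneg fun i _ => sq_nonneg _)
  have hint : Integrable (fun x => X x ^ 2) (stdGaussian E) := by
    simp_rw [hsq]
    exact integrable_finsetSum _ fun i _ => integrable_inner_sq_stdGaussian (w i)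
  have hX : MemLp X 2 (stdGaussian E) :=
    (memLp_two_iff_integrable_sq (integrable_sqrt_sum_inner_sq w).aestronglyMeasurable).2 hint
  have h := variance_nonneg X (stdGaussian E)
  rw [variance_eq_sub hX] at h
  have h2 : ∫ x, (X ^ 2) x ∂(stdGaussian E) = ∑ i, ‖w i‖ ^ 2 := by
    simp_rw [Pi.pow_apply, hsq]
    rw [integral_finsetSum _ fun i _ => integrable_inner_sq_stdGaussian (w i)]
    simp_rw [integral_inner_sq_stdGaussian]
  rw [h2] at h
  exact Real.le_sqrt_of_sq_le (by linarith)

end Moments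

lemma sum_mul_le_sqrt_sum_sq {ι : Type*} [Fintype ι] {p q : ι → ℝ} (hp : ∑ i, p i ^ 2 ≤ 1) :
    ∑ i, p i * q i ≤ √(∑ i, q i ^ 2) := by
  refine Real.le_sqrt_of_sq_le ((Finset.sum_mul_sq_le_sq_mul_sq _ p q).trans ?_)
  exact mul_le_of_le_one_left (Finset.sum_nonneg fun i _ => sq_nonneg _) hp

section Chevet

variable {m κ ν r : Type*} [Fintype m] [Fintype κ] [Fintype ν] [Fintype r]

/-- Gaussian comparison for finitely many bilinear forms of a Gaussian matrix. -/
lemma integral_iSup_bilin_le {T : Type*} [Fintype T] [Nonempty T] (S : Matrix m κ ℝ)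
    (R : Matrix ν r ℝ) {σ τ : ℝ} (u : T → m → ℝ) (v : T → r → ℝ)
    (hu : ∀ t, ∑ i, u t i ^ 2 ≤ 1) (hv : ∀ t, ∑ i, v t i ^ 2 ≤ 1)
    (hσ : ∀ t, ‖WithLp.toLp 2 (Sᵀ *ᵥ u t)‖ ≤ σ) (hτ : ∀ t, ‖WithLp.toLp 2 (R *ᵥ v t)‖ ≤ τ) :
    ∫ G, ⨆ t, (Sᵀ *ᵥ u t) ⬝ᵥ (of G *ᵥ (R *ᵥ v t)) ∂(gaussMat κ ν) ≤
      σ * √(∑ i, ∑ j, R i j ^ 2) + √(∑ i, ∑ j, S i j ^ 2) * τ := by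
  obtain ⟨t₀⟩ : Nonempty T := inferInstance
  have hσ0 : 0 ≤ σ := (norm_nonneg _).trans (hσ t₀)
  have hτ0 : 0 ≤ τ := (norm_nonneg _).trans (hτ t₀)
  set x : T → EuclideanSpace ℝ κ := fun t => WithLp.toLp 2 (Sᵀ *ᵥ u t) with hx
  set y : T → EuclideanSpace ℝ ν := fun t => WithLp.toLp 2 (R *ᵥ v t) with hy
  set a : T → EuclideanSpace ℝ ((κ × ν) ⊕ (κ ⊕ ν)) := fun t =>
    WithLp.toLp 2 (Sum.elim (fun p => x t p.1 * y t p.2) 0) with ha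
  set b : T → EuclideanSpace ℝ ((κ × ν) ⊕ (κ ⊕ ν)) := fun t =>
    WithLp.toLp 2 (Sum.elim 0 (Sum.elim (fun i => τ * x t i) (fun j => ‖x t‖ * y t j))) with hb
  have haa : ∀ s t, inner ℝ (a s) (a t) = inner ℝ (x s) (x t) * inner ℝ (y s) (y t) := by
    intro s t
    simp only [ha, PiLp.inner_apply, Fintype.sum_sum_type, Fintype.sum_prod_type, Sum.elim_inl,
      Sum.elim_inr, Pi.zero_apply, inner_zero_left, Finset.sum_const_zero, add_zero,
      Finset.sum_mul_sum]
    refine Finset.sum_congr rfl fun i _ => Finset.sum_congr rfl fun j _ => ?_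
    simp
    ring
  have hbb : ∀ s t, inner ℝ (b s) (b t) =
      τ ^ 2 * inner ℝ (x s) (x t) + ‖x s‖ * ‖x t‖ * inner ℝ (y s) (y t) := by
    intro s t
    simp only [hb, PiLp.inner_apply, Fintype.sum_sum_type, Sum.elim_inl,
      Sum.elim_inr, Pi.zero_apply, inner_zero_left, Finset.sum_const_zero, zero_add,
      Finset.mul_sum]
    congr 1 <;> refine Finset.sum_congr rfl fun i _ => ?_ <;> simp <;> ring
  have hab : ∀ s t, inner ℝ (a s) (b t) = 0 := by
    intro s t
    simp [ha, hb, PiLp.inner_apply, Fintype.sum_sum_type]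
  have hinc : ∀ s t, ‖a s - a t‖ ≤ ‖b s - b t‖ := by
    intro s t
    rw [← sq_le_sq₀ (norm_nonneg _) (norm_nonneg _), norm_sub_sq_real, norm_sub_sq_real]
    simp only [← real_inner_self_eq_norm_sq, haa, hbb]
    simp only [real_inner_self_eq_norm_sq]
    have h1 : inner ℝ (x s) (x t) ≤ ‖x s‖ * ‖x t‖ := real_inner_le_norm _ _
    have h2 : inner ℝ (y s) (y t) ≤ τ ^ 2 := (real_inner_le_norm _ _).trans <| by
      rw [pow_two]; exact mul_le_mul (hτ s) (hτ t) (norm_nonneg _) hτ0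
    nlinarith [mul_nonneg (sub_nonneg.2 h1) (sub_nonneg.2 h2), sq_nonneg (‖x s‖ - ‖x t‖),
      mul_nonneg (sq_nonneg τ) (sq_nonneg (‖x s‖ - ‖x t‖))]
  have hSF := integral_iSup_inner_le hab hinc
  set wS : m → EuclideanSpace ℝ ((κ × ν) ⊕ (κ ⊕ ν)) := fun i =>
    WithLp.toLp 2 (Sum.elim 0 (Sum.elim (S i) 0)) with hwS
  set wR : r → EuclideanSpace ℝ ((κ × ν) ⊕ (κ ⊕ ν)) := fun i =>
    WithLp.toLp 2 (Sum.elim 0 (Sum.elim 0 (Rᵀ i))) with hwR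
  have hbz : ∀ t z, inner ℝ (b t) z ≤
      τ * √(∑ i, inner ℝ (wS i) z ^ 2) + σ * √(∑ i, inner ℝ (wR i) z ^ 2) := by
    intro t z
    have h1 : inner ℝ (b t) z =
        τ * ∑ i, u t i * inner ℝ (wS i) z + ‖x t‖ * ∑ i, v t i * inner ℝ (wR i) z := by
      simp only [hb, hwS, hwR, PiLp.inner_apply, Fintype.sum_sum_type, Sum.elim_inl,
        Sum.elim_inr, Pi.zero_apply, inner_zero_left, Finset.sum_const_zero, zero_add, add_zero,
        Finset.mul_sum]
      congr 1
      · rw [Finset.sum_comm]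
        refine Finset.sum_congr rfl fun i _ => ?_
        simp only [hx, mulVec, dotProduct, RCLike.inner_apply, conj_trivial, Finset.mul_sum,
          transpose_apply]
        exact Finset.sum_congr rfl fun j _ => by ring
      · rw [Finset.sum_comm]
        refine Finset.sum_congr rfl fun i _ => ?_
        simp only [hy, mulVec, dotProduct, RCLike.inner_apply, conj_trivial, Finset.mul_sum,
          transpose_apply]
        exact Finset.sum_congr rfl fun j _ => by ring
    rw [h1]
    refine add_le_add (mul_le_mul_of_nonneg_left (sum_mul_le_sqrt_sum_sq (hu t)) hτ0) ?_
    exact (mul_le_mul_of_nonneg_left (sum_mul_le_sqrt_sum_sq (hv t)) (norm_nonneg _)).trans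
      (mul_le_mul_of_nonneg_right (hσ t) (Real.sqrt_nonneg _))
  have hwSn : ∀ i, ‖wS i‖ ^ 2 = ∑ j, S i j ^ 2 := fun i => by
    simp [hwS, EuclideanSpace.norm_sq_eq, Fintype.sum_sum_type]
  have hwRn : ∀ i, ‖wR i‖ ^ 2 = ∑ j, R j i ^ 2 := fun i => by
    simp [hwR, EuclideanSpace.norm_sq_eq, Fintype.sum_sum_type]
  have hlaw : gaussMat κ ν = (stdGaussian (EuclideanSpace ℝ ((κ × ν) ⊕ (κ ⊕ ν)))).map
      (fun z i j => z (Sum.inl (i, j))) := by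
    have h := map_stdGaussian_of_inner (E := EuclideanSpace ℝ ((κ × ν) ⊕ (κ ⊕ ν)))
      (F := EuclideanSpace ℝ (κ × ν)) (L := fun z => WithLp.toLp 2 fun p => z (Sum.inl p))
      (by fun_prop) (J := fun t => WithLp.toLp 2 (Sum.elim t 0))
      (fun t => by simp [EuclideanSpace.norm_eq, Fintype.sum_sum_type])
      (fun z t => by simp [PiLp.inner_apply, Fintype.sum_sum_type])
    rw [← map_curry_stdGaussian, ← h, Measure.map_map (by fun_prop) (by fun_prop)]
    rfl
  rw [hlaw, integral_map (by fun_prop)]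
  · calc _ = ∫ z, ⨆ t, inner ℝ (a t) z ∂(stdGaussian (EuclideanSpace ℝ ((κ × ν) ⊕ (κ ⊕ ν)))) := by
          refine integral_congr_ae (Filter.Eventually.of_forall fun z => ?_)
          refine iSup_congr fun t => ?_
          simp only [ha, hx, hy, PiLp.inner_apply, Fintype.sum_sum_type, Fintype.sum_prod_type,
            Sum.elim_inl, Sum.elim_inr, Pi.zero_apply, mul_zero, Finset.sum_const_zero, add_zero,
            RCLike.inner_apply, conj_trivial]
          rw [dotProduct]
          refine Finset.sum_congr rfl fun i _ => ?_
          rw [show (of (fun i j => z (Sum.inl (i, j))) *ᵥ (R *ᵥ v t)) i =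
            ∑ j, z (Sum.inl (i, j)) * (R *ᵥ v t) j from rfl, Finset.mul_sum]
          exact Finset.sum_congr rfl fun j _ => by ring
      _ ≤ _ := hSF
      _ ≤ ∫ z, (τ * √(∑ i, inner ℝ (wS i) z ^ 2) + σ * √(∑ i, inner ℝ (wR i) z ^ 2))
            ∂(stdGaussian (EuclideanSpace ℝ ((κ × ν) ⊕ (κ ⊕ ν)))) :=
          integral_mono (integrable_iSup_inner b)
            (((integrable_sqrt_sum_inner_sq wS).const_mul _).add
              ((integrable_sqrt_sum_inner_sq wR).const_mul _)) fun z => ciSup_le fun t => hbz t z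
      _ ≤ τ * √(∑ i, ‖wS i‖ ^ 2) + σ * √(∑ i, ‖wR i‖ ^ 2) := by
          rw [integral_add ((integrable_sqrt_sum_inner_sq wS).const_mul _)
              ((integrable_sqrt_sum_inner_sq wR).const_mul _), integral_const_mul,
            integral_const_mul]
          exact add_le_add
            (mul_le_mul_of_nonneg_left (integral_sqrt_sum_inner_sq_le wS) hτ0)
            (mul_le_mul_of_nonneg_left (integral_sqrt_sum_inner_sq_le wR) hσ0)
      _ = _ := by
          simp_rw [hwSn, hwRn]
          rw [Finset.sum_comm (f := fun i j => R j i ^ 2)]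
          ring
  · exact (Measurable.iSup fun t => by simp only [dotProduct, mulVec, of_apply]; fun_prop).aestronglyMeasurable

open scoped Matrix.Norms.L2Operator

lemma l2_opNorm_toLp_mulVec_le [DecidableEq r] (M : Matrix m r ℝ) (v : r → ℝ) :
    ‖WithLp.toLp 2 (M *ᵥ v)‖ ≤ ‖M‖ * ‖WithLp.toLp 2 v‖ :=
  l2_opNorm_mulVec M (WithLp.toLp 2 v)

lemma l2_opNorm_le_of_forall_bilin [DecidableEq r] (M : Matrix m r ℝ) {c : ℝ} (hc : 0 ≤ c)
    (h : ∀ (u : EuclideanSpace ℝ m) (v : EuclideanSpace ℝ r), ‖u‖ ≤ 1 → ‖v‖ ≤ 1 →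
      u ⬝ᵥ M *ᵥ v ≤ c) : ‖M‖ ≤ c := by
  rw [l2_opNorm_def]
  refine ContinuousLinearMap.opNorm_le_of_unit_norm hc fun v hv => ?_
  set w : EuclideanSpace ℝ m := WithLp.toLp 2 (M *ᵥ v) with hw
  change ‖w‖ ≤ c
  by_cases hw0 : ‖w‖ = 0
  · rw [hw0]; exact hc
  have h1 := h (‖w‖⁻¹ • w) v (by rw [norm_smul, norm_inv, norm_norm, inv_mul_cancel₀ hw0]) hv.le
  have h2 : (‖w‖⁻¹ • w : EuclideanSpace ℝ m) ⬝ᵥ M *ᵥ v = ‖w‖ := by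
    have : w.ofLp ⬝ᵥ M *ᵥ v = ‖w‖ ^ 2 := by
      rw [EuclideanSpace.real_norm_sq_eq, hw]
      simp [dotProduct, pow_two]
    rw [WithLp.ofLp_smul, smul_dotProduct, this, smul_eq_mul]
    field_simp
  rwa [h2] at h1

lemma dotProduct_mul_mul_mulVec (S : Matrix m κ ℝ) (G : Matrix κ ν ℝ) (R : Matrix ν r ℝ)
    (u : m → ℝ) (v : r → ℝ) :
    u ⬝ᵥ (S * G * R) *ᵥ v = (Sᵀ *ᵥ u) ⬝ᵥ (G *ᵥ (R *ᵥ v)) := by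
  rw [← mulVec_mulVec, ← mulVec_mulVec, dotProduct_mulVec, ← mulVec_transpose]

/-- Chevet's inequality with constant one for the operator norm of `S G R`, `G` Gaussian. -/
theorem lintegral_l2_opNorm_le [DecidableEq m] [DecidableEq κ] [DecidableEq r]
    (S : Matrix m κ ℝ) (R : Matrix ν r ℝ) :
    ∫⁻ G, ENNReal.ofReal ‖S * of G * R‖ ∂(gaussMat κ ν) ≤ ENNReal.ofReal
      (‖S‖ * √(∑ i, ∑ j, R i j ^ 2) + √(∑ i, ∑ j, S i j ^ 2) * ‖R‖) := by
  set K : Set (EuclideanSpace ℝ m × EuclideanSpace ℝ r) :=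
    Metric.closedBall 0 1 ×ˢ Metric.closedBall 0 1 with hK
  have hK0 : (0 : EuclideanSpace ℝ m × EuclideanSpace ℝ r) ∈ K := by simp [hK]
  have : Nonempty K := ⟨⟨0, hK0⟩⟩
  obtain ⟨d, hd⟩ := TopologicalSpace.exists_dense_seq K
  set e : ℕ → K := fun n => Nat.casesOn n ⟨0, hK0⟩ d with he
  have he1 : ∀ n, ‖(e n).1.1‖ ≤ 1 := fun n => by simpa using (e n).2.1
  have he2 : ∀ n, ‖(e n).1.2‖ ≤ 1 := fun n => by simpa using (e n).2.2
  set q : (κ → ν → ℝ) → ℕ → ℝ := fun G n =>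
    (Sᵀ *ᵥ (e n).1.1) ⬝ᵥ (of G *ᵥ (R *ᵥ (e n).1.2)) with hq
  set f : ℕ → (κ → ν → ℝ) → ℝ := fun n G => ⨆ i : Fin (n + 1), q G i with hf
  have hqm : ∀ n, Measurable fun G => q G n := fun n => by
    simp only [hq, dotProduct, mulVec, of_apply]; fun_prop
  have hfm : ∀ n, Measurable (f n) := fun n => Measurable.iSup fun i => hqm i
  have hqf : ∀ G n (i : Fin (n + 1)), q G i ≤ f n G := fun G n i =>
    le_ciSup (f := fun i : Fin (n + 1) => q G i) (Set.finite_range _).bddAbove i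
  have hf0 : ∀ n G, 0 ≤ f n G := fun n G => by
    have h := hqf G n 0
    have h0 : q G ((0 : Fin (n + 1)) : ℕ) = 0 := by simp [hq, he]
    linarith
  have hfmono : ∀ G, Monotone fun n => f n G := fun G i j hij =>
    ciSup_le fun l => hqf G j ⟨l, by omega⟩
  have hbound : ∀ G : κ → ν → ℝ, ENNReal.ofReal ‖S * of G * R‖ ≤ ⨆ n, ENNReal.ofReal (f n G) := by
    intro G
    by_cases htop : (⨆ n, ENNReal.ofReal (f n G)) = ⊤
    · rw [htop]; exact le_top
    refine ENNReal.ofReal_le_of_le_toReal ?_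
    set c := (⨆ n, ENNReal.ofReal (f n G)).toReal
    have hqc : ∀ n, q G n ≤ c := fun n => by
      refine (hqf G n (Fin.last n)).trans ?_
      rw [← ENNReal.ofReal_le_iff_le_toReal htop]
      exact le_iSup (fun n => ENNReal.ofReal (f n G)) n
    have hclosed : IsClosed {z : K | z.1.1 ⬝ᵥ (S * of G * R) *ᵥ z.1.2 ≤ c} := by
      refine isClosed_le ?_ continuous_const
      simp only [dotProduct, mulVec]
      fun_prop
    have hall : ∀ z : K, z.1.1 ⬝ᵥ (S * of G * R) *ᵥ z.1.2 ≤ c := by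
      intro z
      refine hclosed.closure_subset_iff.2 ?_ (hd z)
      rintro _ ⟨n, rfl⟩
      have := hqc (n + 1)
      simpa only [Set.mem_ofPred_eq, dotProduct_mul_mul_mulVec, hq] using this
    exact l2_opNorm_le_of_forall_bilin _ ENNReal.toReal_nonneg fun u v hu hv =>
      hall ⟨(u, v), by simpa [hK] using ⟨hu, hv⟩⟩
  refine (lintegral_mono hbound).trans ?_
  rw [lintegral_iSup (fun n => (hfm n).ennreal_ofReal)
    (fun i j hij G => ENNReal.ofReal_le_ofReal (hfmono G hij))]
  refine iSup_le fun n => ?_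
  have hentry : ∀ a b, Integrable (fun G : κ → ν → ℝ => G a b) (gaussMat κ ν) := fun a b =>
    (measurePreserving_eval (fun _ : κ => gaussVec ν) a).integrable_comp_of_integrable
      ((measurePreserving_eval (fun _ : ν => gaussianReal 0 1) b).integrable_comp_of_integrable
        ((memLp_id_gaussianReal 1).integrable le_rfl))
  have hqint : ∀ i, Integrable (fun G => q G i) (gaussMat κ ν) := fun i => by
    simp only [hq, dotProduct, mulVec, of_apply]
    exact integrable_finsetSum _ fun a _ => (integrable_finsetSum _ fun b _ =>
      (hentry a b).mul_const _).const_mul _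
  have hint : Integrable (f n) (gaussMat κ ν) := by
    refine (integrable_finsetSum Finset.univ fun (i : Fin (n + 1)) _ => (hqint i).abs).mono'
      (hfm n).aestronglyMeasurable (Filter.Eventually.of_forall fun G => ?_)
    rw [Real.norm_of_nonneg (hf0 n G)]
    exact ciSup_le fun i => (le_abs_self _).trans
      (Finset.single_le_sum (f := fun i : Fin (n + 1) => |q G i|) (fun _ _ => abs_nonneg _)
        (Finset.mem_univ i))
  rw [← ofReal_integral_eq_lintegral_ofReal hint (Filter.Eventually.of_forall (hf0 n))]
  refine ENNReal.ofReal_le_ofReal (integral_iSup_bilin_le S R (fun i : Fin (n + 1) => (e i).1.1)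
    (fun i => (e i).1.2) (fun i => ?_) (fun i => ?_) (fun i => ?_) (fun i => ?_))
  · rw [← EuclideanSpace.real_norm_sq_eq]
    exact pow_le_one₀ (norm_nonneg _) (he1 i)
  · rw [← EuclideanSpace.real_norm_sq_eq]
    exact pow_le_one₀ (norm_nonneg _) (he2 i)
  · refine (l2_opNorm_toLp_mulVec_le _ _).trans ?_
    rw [← conjTranspose_eq_transpose_of_trivial, l2_opNorm_conjTranspose]
    exact mul_le_of_le_one_right (norm_nonneg _) (he1 i)
  · exact (l2_opNorm_toLp_mulVec_le _ _).trans
      (mul_le_of_le_one_right (norm_nonneg _) (he2 i))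

end Chevet

section Pseudoinverse

variable {κ ν : Type*} [Fintype κ] [Fintype ν] [DecidableEq κ]

lemma norm_toLp_sq {ι : Type*} [Fintype ι] (x : ι → ℝ) : ‖WithLp.toLp 2 x‖ ^ 2 = x ⬝ᵥ x := by
  rw [EuclideanSpace.real_norm_sq_eq]
  simp [dotProduct, pow_two]

lemma dotProduct_le_norm_mul_norm {ι : Type*} [Fintype ι] (x y : ι → ℝ) :
    x ⬝ᵥ y ≤ ‖WithLp.toLp 2 x‖ * ‖WithLp.toLp 2 y‖ := by
  refine le_trans (le_of_eq ?_) (real_inner_le_norm (WithLp.toLp 2 y) (WithLp.toLp 2 x) |>.trans_eq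
    (mul_comm _ _))
  simp [PiLp.inner_apply, dotProduct]

/-- The Moore-Penrose right inverse of a matrix with independent rows. -/
def rightPinv (G : κ → ν → ℝ) : Matrix ν κ ℝ := (of G)ᵀ * (of G * (of G)ᵀ)⁻¹

lemma of_mul_rightPinv {G : κ → ν → ℝ} (hG : LinearIndependent ℝ G) : of G * rightPinv G = 1 := by
  rw [rightPinv, ← Matrix.mul_assoc]
  refine Matrix.mul_nonsing_inv _ ((Matrix.isUnit_iff_isUnit_det _).1
    (Matrix.mulVec_injective_iff_isUnit.1 ?_))
  refine (injective_iff_map_eq_zero (of G * (of G)ᵀ).mulVecLin).2 fun z hz => ?_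
  have h := (Matrix.self_mul_conjTranspose_mulVec_eq_zero (of G) z).1
    (by rwa [conjTranspose_eq_transpose_of_trivial])
  rw [conjTranspose_eq_transpose_of_trivial, mulVec_transpose] at h
  exact (Matrix.vecMul_injective_iff (M := of G)).2 hG (by simpa using h)

lemma norm_rightPinv_mulVec_le {G : κ → ν → ℝ} {y : ν → ℝ} {h : κ → ℝ} (hy : of G *ᵥ y = h) :
    ‖WithLp.toLp 2 (rightPinv G *ᵥ h)‖ ≤ ‖WithLp.toLp 2 y‖ := by
  by_cases hu : IsUnit (of G * (of G)ᵀ).det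
  · set z := (of G * (of G)ᵀ)⁻¹ *ᵥ h with hz
    have h1 : rightPinv G *ᵥ h = (of G)ᵀ *ᵥ z := by rw [rightPinv, hz, mulVec_mulVec]
    have h2 : of G *ᵥ ((of G)ᵀ *ᵥ z) = h := by
      rw [mulVec_mulVec, hz, mulVec_mulVec, Matrix.mul_nonsing_inv _ hu, one_mulVec]
    have h3 : ((of G)ᵀ *ᵥ z) ⬝ᵥ ((of G)ᵀ *ᵥ z) = ((of G)ᵀ *ᵥ z) ⬝ᵥ y := by
      rw [mulVec_transpose, ← dotProduct_mulVec, ← dotProduct_mulVec, hy, ← mulVec_transpose, h2]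
    have h4 := dotProduct_le_norm_mul_norm ((of G)ᵀ *ᵥ z) y
    rw [← h3, ← norm_toLp_sq] at h4
    rw [h1]
    nlinarith [norm_nonneg (WithLp.toLp 2 ((of G)ᵀ *ᵥ z)), norm_nonneg (WithLp.toLp 2 y)]
  · rw [rightPinv, Matrix.nonsing_inv_apply_not_isUnit _ hu]
    simp

lemma measurable_rightPinv_apply (a : ν) (b : κ) :
    Measurable fun G : κ → ν → ℝ => rightPinv G a b := by
  have hdet : ∀ f : (κ → ν → ℝ) → Matrix κ κ ℝ, (∀ i j, Measurable fun G => f G i j) →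
      Measurable fun G => (f G).det := fun f hf => by
    simp only [det_apply]
    exact Finset.measurable_fun_sum _ fun s _ =>
      (Finset.measurable_fun_prod _ fun i _ => hf _ _).const_smul _
  have hgram : ∀ i j, Measurable fun G : κ → ν → ℝ => (of G * (of G)ᵀ) i j := fun i j => by
    simp only [mul_apply, transpose_apply, of_apply]
    fun_prop
  have hinv : ∀ i j, Measurable fun G : κ → ν → ℝ => (of G * (of G)ᵀ)⁻¹ i j := fun i j => by
    simp only [Matrix.inv_def, Ring.inverse_eq_inv', Matrix.smul_apply, adjugate_apply, smul_eq_mul]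
    refine (hdet _ hgram).inv.mul (hdet _ fun a b => ?_)
    simp only [updateRow_apply]
    split_ifs
    · exact measurable_const
    · exact hgram a b
  simp only [rightPinv, mul_apply (M := (of _)ᵀ), transpose_apply, of_apply]
  exact Finset.measurable_fun_sum _ fun i _ => (by fun_prop : Measurable _).mul (hinv i b)

lemma measurable_norm_rightPinv_mulVec (h : κ → ℝ) :
    Measurable fun G : κ → ν → ℝ => ‖WithLp.toLp 2 (rightPinv G *ᵥ h)‖ := by
  refine (Measurable.norm ?_)
  refine (WithLp.measurable_toLp 2 _).comp (measurable_pi_lambda _ fun a => ?_)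
  simp only [mulVec, dotProduct]
  exact Finset.measurable_fun_sum _ fun b _ => (measurable_rightPinv_apply a b).mul_const _

end Pseudoinverse

section Rotation

variable {κ ν : Type*} [Fintype κ] [Fintype ν] [DecidableEq κ]

lemma map_mul_gaussMat {W : Matrix κ κ ℝ} (hW : W * Wᵀ = 1) :
    (gaussMat κ ν).map (fun G i j => (W * of G) i j) = gaussMat κ ν := by
  have h := map_stdGaussian_of_inner (E := EuclideanSpace ℝ (κ × ν))
    (F := EuclideanSpace ℝ (κ × ν))
    (L := fun x => WithLp.toLp 2 fun p => ∑ i, W p.1 i * x (i, p.2)) (by fun_prop)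
    (J := fun t => WithLp.toLp 2 fun p => ∑ i, W i p.1 * t (i, p.2))
    (fun t => by
      rw [← sq_eq_sq₀ (norm_nonneg _) (norm_nonneg _), EuclideanSpace.real_norm_sq_eq,
        EuclideanSpace.real_norm_sq_eq, Fintype.sum_prod_type_right, Fintype.sum_prod_type_right]
      refine Finset.sum_congr rfl fun j _ => ?_
      set y : κ → ℝ := fun i => t (i, j) with hy
      have h1 : (Wᵀ *ᵥ y) ⬝ᵥ (Wᵀ *ᵥ y) = y ⬝ᵥ y := by
        rw [mulVec_transpose, ← dotProduct_mulVec, ← mulVec_transpose, mulVec_mulVec, hW,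
          one_mulVec]
      simpa [dotProduct, mulVec, pow_two] using h1)
    (fun x t => by
      simp only [PiLp.inner_apply, RCLike.inner_apply, conj_trivial]
      rw [Fintype.sum_prod_type_right, Fintype.sum_prod_type_right]
      refine Finset.sum_congr rfl fun j _ => ?_
      simp only [Finset.mul_sum, Finset.sum_mul]
      rw [Finset.sum_comm]
      exact Finset.sum_congr rfl fun i _ => Finset.sum_congr rfl fun i' _ => by ring)
  conv_rhs => rw [← map_curry_stdGaussian, ← h]
  have hm : Measurable fun (G : κ → ν → ℝ) i j => (W * of G) i j := by
    simp only [mul_apply, of_apply]; fun_prop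
  rw [Measure.map_map (by fun_prop) (by fun_prop), ← map_curry_stdGaussian,
    Measure.map_map hm (by fun_prop)]
  rfl

end Rotation

section Resample

variable {κ ν : Type*} [Fintype κ] [Fintype ν] [DecidableEq κ]

/-- Resampling a single coordinate bounds an integral with respect to a product measure. -/
lemma lintegral_pi_le_of_forall_update {X : κ → Type*} [∀ i, MeasurableSpace (X i)]
    {μ : ∀ i, Measure (X i)} [∀ i, IsProbabilityMeasure (μ i)] {f : (∀ i, X i) → ENNReal}
    (hf : Measurable f) (i : κ) {c : ENNReal}
    (h : ∀ x, ∫⁻ r, f (Function.update x i r) ∂(μ i) ≤ c) : ∫⁻ x, f x ∂(Measure.pi μ) ≤ c := by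
  refine (lintegral_le_of_lmarginal_le (μ := μ) {i} hf (measurable_const (a := c)) ?_).trans_eq
    (by simp)
  rw [lmarginal_singleton, lmarginal_singleton]
  intro x
  simpa using h x

lemma gaussVec_submodule_eq_zero {s : Submodule ℝ (ν → ℝ)} (hs : s ≠ ⊤) :
    gaussVec ν s = 0 := by
  have hms : MeasurableSet (s : Set (ν → ℝ)) := s.closed_of_finiteDimensional.measurableSet
  rw [← map_ofLp_stdGaussian, Measure.map_apply (by fun_prop) hms]
  obtain ⟨C, -, hC⟩ := stdGaussian_eq_withDensity (E := EuclideanSpace ℝ ν)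
  rw [hC]
  refine withDensity_absolutelyContinuous _ _ ?_
  refine Measure.addHaar_submodule volume (s.comap (WithLp.linearEquiv 2 ℝ (ν → ℝ)).toLinearMap)
    fun h => hs ?_
  rw [eq_top_iff]
  intro x _
  have : WithLp.toLp 2 x ∈ s.comap (WithLp.linearEquiv 2 ℝ (ν → ℝ)).toLinearMap := by rw [h]; trivial
  simpa using this

lemma stdGaussian_singleton_zero (d : ℕ) :
    stdGaussian (EuclideanSpace ℝ (Fin (d + 1))) {0} = 0 := by
  obtain ⟨C, -, hC⟩ := stdGaussian_eq_withDensity (E := EuclideanSpace ℝ (Fin (d + 1)))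
  rw [hC]
  exact withDensity_absolutelyContinuous _ _ (measure_singleton 0)

/-- Almost surely the rows of a wide Gaussian matrix are linearly independent. -/
lemma ae_linearIndependent_gaussMat (hcard : Fintype.card κ ≤ Fintype.card ν) :
    ∀ᵐ G ∂(gaussMat κ ν), LinearIndependent ℝ G := by
  have key : ∀ s : Finset κ, ∀ᵐ G ∂(gaussMat κ ν), LinearIndepOn ℝ G (s : Set κ) := by
    intro s
    induction s using Finset.induction_on with
    | empty => simp [linearIndepOn_empty]
    | insert i s hi ih =>
      have hmeas : ∀ t : Finset κ, MeasurableSet {G : κ → ν → ℝ | LinearIndepOn ℝ G (t : Set κ)} :=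
        fun t => by
          have h1 : MeasurableSet {g : ↥(t : Set κ) → ν → ℝ | LinearIndependent ℝ g} :=
            isOpen_setOfPred_linearIndependent.measurableSet
          have h2 : Measurable fun (G : κ → ν → ℝ) (i : (t : Set κ)) => G i := by fun_prop
          exact h2 h1
      set A := {G : κ → ν → ℝ | LinearIndepOn ℝ G (s : Set κ)} ∩
        {G | LinearIndepOn ℝ G (insert i s : Finset κ)}ᶜ with hA
      have hAm : MeasurableSet A := (hmeas s).inter (hmeas (insert i s)).compl
      have hA0 : gaussMat κ ν A = 0 := by
        rw [← lintegral_indicator_one hAm, ← nonpos_iff_eq_zero]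
        refine lintegral_pi_le_of_forall_update (measurable_one.indicator hAm) i fun x => ?_
        set V := Submodule.span ℝ (x '' (s : Set κ)) with hV
        have hVtop : V ≠ ⊤ := by
          intro h
          have h1 := finrank_span_finset_le_card (R := ℝ) (s.image x)
          rw [Finset.coe_image, Set.finrank, ← hV, h, finrank_top, Module.finrank_fintype_fun_eq_card] at h1
          have h2 : s.card < Fintype.card κ := Finset.card_lt_univ_of_notMem hi
          have h3 := Finset.card_image_le (s := s) (f := x)
          omega
        have hsub : ∀ r, Function.update x i r ∈ A → r ∈ V := fun r ⟨hr1, hr2⟩ => by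
          by_contra hr3
          refine hr2 ?_
          simp only [Set.mem_ofPred_eq]
          rw [Finset.coe_insert, linearIndepOn_insert (by simpa using hi), Function.update_self]
          refine ⟨hr1, ?_⟩
          rwa [Set.image_congr (g := x) fun j hj => Function.update_of_ne
            (fun h => hi (by simpa [h] using hj)) _ _]
        calc ∫⁻ r, A.indicator 1 (Function.update x i r) ∂(gaussVec ν)
            ≤ ∫⁻ r, (V : Set (ν → ℝ)).indicator 1 r ∂(gaussVec ν) := lintegral_mono fun r => by
              by_cases hr : Function.update x i r ∈ A
              · rw [Set.indicator_of_mem hr, Set.indicator_of_mem (hsub r hr)]; rfl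
              · rw [Set.indicator_of_notMem hr]; exact zero_le
          _ = 0 := by
            rw [lintegral_indicator_one V.closed_of_finiteDimensional.measurableSet,
              gaussVec_submodule_eq_zero hVtop]
          _ ≤ 0 := le_rfl
      have : ∀ᵐ G ∂(gaussMat κ ν), G ∉ A := measure_eq_zero_iff_ae_notMem.1 hA0
      filter_upwards [ih, this] with G h1 h2
      by_contra h3
      exact h2 ⟨h1, h3⟩
  filter_upwards [key Finset.univ] with G hG
  simpa using hG

/-- Negative moments of one column of the right inverse of a Gaussian matrix. -/
lemma lintegral_rightPinv_single_le {p : ℕ} (hcard : Fintype.card ν = Fintype.card κ + p) (i : κ)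
    (q : ℕ) :
    ∫⁻ G, ENNReal.ofReal (‖WithLp.toLp 2 (rightPinv G *ᵥ Pi.single i 1)‖ ^ q) ∂(gaussMat κ ν) ≤
      ∫⁻ g, ENNReal.ofReal (‖g‖⁻¹ ^ q) ∂(stdGaussian (EuclideanSpace ℝ (Fin (p + 1)))) := by
  refine lintegral_pi_le_of_forall_update
    ((measurable_norm_rightPinv_mulVec _).pow_const q).ennreal_ofReal i fun x => ?_
  set V : Submodule ℝ (EuclideanSpace ℝ ν) :=
    Submodule.span ℝ ((Finset.univ.erase i).image fun j => WithLp.toLp 2 (x j)) with hV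
  have hVdim : p + 1 ≤ Module.finrank ℝ Vᗮ := by
    have h1 := V.finrank_add_finrank_orthogonal
    have h2 := finrank_span_finset_le_card (R := ℝ)
      ((Finset.univ.erase i).image fun j => (WithLp.toLp 2 (x j) : EuclideanSpace ℝ ν))
    have h3 := Finset.card_image_le (s := Finset.univ.erase i)
      (f := fun j => (WithLp.toLp 2 (x j) : EuclideanSpace ℝ ν))
    rw [Finset.card_erase_of_mem (Finset.mem_univ i), Finset.card_univ] at h3
    rw [finrank_euclideanSpace, hcard] at h1
    have h4 : 0 < Fintype.card κ := Fintype.card_pos_iff.2 ⟨i⟩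
    have h5 : Module.finrank ℝ V ≤ _ := h2
    omega
  set u : Fin (p + 1) → EuclideanSpace ℝ ν := fun a =>
    (stdOrthonormalBasis ℝ Vᗮ (Fin.castLE hVdim a) : Vᗮ) with hu
  have hu_orth : Orthonormal ℝ u := by
    have h1 := ((stdOrthonormalBasis ℝ Vᗮ).orthonormal.comp (Fin.castLE hVdim)
      (Fin.castLE_injective hVdim))
    exact h1.comp_linearIsometry Vᗮ.subtypeₗᵢ
  have hu_mem : ∀ a j, j ≠ i → inner ℝ (u a) (WithLp.toLp 2 (x j)) = 0 := fun a j hj =>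
    Submodule.inner_left_of_mem_orthogonal (K := V) (Submodule.subset_span (by
      simpa using ⟨j, hj, rfl⟩)) (Subtype.prop _)
  set L : EuclideanSpace ℝ ν → EuclideanSpace ℝ (Fin (p + 1)) := fun r =>
    WithLp.toLp 2 fun a => inner ℝ (u a) r with hL
  have hLm : Measurable L := by fun_prop
  have hlaw : (stdGaussian (EuclideanSpace ℝ ν)).map L =
      stdGaussian (EuclideanSpace ℝ (Fin (p + 1))) :=
    map_stdGaussian_of_inner hLm (J := fun t => ∑ a, t a • u a)
      (fun t => by
        rw [← sq_eq_sq₀ (norm_nonneg _) (norm_nonneg _), ← real_inner_self_eq_norm_sq,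
          hu_orth.inner_sum, EuclideanSpace.real_norm_sq_eq]
        simp [pow_two])
      (fun r t => by
        rw [inner_sum, PiLp.inner_apply]
        exact Finset.sum_congr rfl fun a _ => by
          rw [inner_smul_right, real_inner_comm, real_inner_comm (u a) r]
          simp only [hL, RCLike.inner_apply, conj_trivial]
          ring)
  have hf : Measurable fun g : EuclideanSpace ℝ (Fin (p + 1)) => ENNReal.ofReal (‖g‖⁻¹ ^ q) := by
    fun_prop
  rw [← hlaw, lintegral_map hf hLm, ← map_ofLp_stdGaussian, lintegral_map _ (by fun_prop)]
  · have hne : ∀ᵐ r ∂(stdGaussian (EuclideanSpace ℝ ν)), L r ≠ 0 := by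
      have := stdGaussian_singleton_zero p
      rw [← hlaw, Measure.map_apply hLm (measurableSet_singleton _)] at this
      exact measure_eq_zero_iff_ae_notMem.1 this
    refine lintegral_mono_ae ?_
    filter_upwards [hne] with r hr
    refine ENNReal.ofReal_le_ofReal (pow_le_pow_left₀ (norm_nonneg _) ?_ q)
    set y : EuclideanSpace ℝ ν := (‖L r‖ ^ 2)⁻¹ • ∑ a, L r a • u a with hy
    have hyn : ‖y‖ = ‖L r‖⁻¹ := by
      have h1 : ‖∑ a, L r a • u a‖ = ‖L r‖ := by
        rw [← sq_eq_sq₀ (norm_nonneg _) (norm_nonneg _), ← real_inner_self_eq_norm_sq,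
          hu_orth.inner_sum, EuclideanSpace.real_norm_sq_eq]
        simp [pow_two]
      rw [hy, norm_smul, h1, Real.norm_of_nonneg (by positivity)]
      have : ‖L r‖ ≠ 0 := norm_ne_zero_iff.2 hr
      field_simp
    rw [← hyn]
    refine norm_rightPinv_mulVec_le (y := y.ofLp) ?_
    have hin : ∀ (z : ν → ℝ), z ⬝ᵥ y.ofLp = inner ℝ y (WithLp.toLp 2 z) := fun z => by
      simp [PiLp.inner_apply, dotProduct]
    ext j
    change (Function.update x i r.ofLp j) ⬝ᵥ y.ofLp = _
    rw [hin, hy, inner_smul_left, sum_inner]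
    simp only [inner_smul_left, conj_trivial]
    by_cases hj : j = i
    · subst hj
      have hr0 : ‖L r‖ ^ 2 ≠ 0 := by simpa using hr
      have h1 : ∑ a, L r a * inner ℝ (u a) r = ‖L r‖ ^ 2 := by
        rw [EuclideanSpace.real_norm_sq_eq]
        exact Finset.sum_congr rfl fun a _ => by rw [pow_two]
      simp only [Function.update_self, Pi.single_eq_same]
      change (‖L r‖ ^ 2)⁻¹ * ∑ a, L r a * inner ℝ (u a) r = 1
      rw [h1, inv_mul_cancel₀ hr0]
    · simp only [Function.update_of_ne hj, Pi.single_eq_of_ne hj]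
      simp [hu_mem _ j hj]
  · exact ((measurable_norm_rightPinv_mulVec _).comp (measurable_update x)).pow_const q
      |>.ennreal_ofReal

lemma rightPinv_mul {W : Matrix κ κ ℝ} (hW : W * Wᵀ = 1) (G : κ → ν → ℝ) :
    rightPinv (fun i j => (W * of G) i j) = rightPinv G * Wᵀ := by
  have h1 : W⁻¹ = Wᵀ := Matrix.inv_eq_right_inv hW
  have h2 : Wᵀ⁻¹ = W := by rw [Matrix.inv_eq_left_inv hW]
  have h3 : Wᵀ * W = 1 := mul_eq_one_comm.1 hW
  change (W * of G)ᵀ * ((W * of G) * (W * of G)ᵀ)⁻¹ = _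
  rw [rightPinv, transpose_mul, show W * of G * ((of G)ᵀ * Wᵀ) = W * (of G * (of G)ᵀ) * Wᵀ by
    simp only [Matrix.mul_assoc], Matrix.mul_inv_rev, Matrix.mul_inv_rev, h1, h2]
  rw [Matrix.mul_assoc, ← Matrix.mul_assoc Wᵀ, h3, Matrix.one_mul, Matrix.mul_assoc]

/-- Negative moments of the right inverse of a Gaussian matrix applied to a fixed vector. -/
lemma lintegral_rightPinv_mulVec_le {p : ℕ} (hcard : Fintype.card ν = Fintype.card κ + p)
    (h : κ → ℝ) {q : ℕ} (hq : q ≠ 0) :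
    ∫⁻ G, ENNReal.ofReal (‖WithLp.toLp 2 (rightPinv G *ᵥ h)‖ ^ q) ∂(gaussMat κ ν) ≤
      ENNReal.ofReal (‖WithLp.toLp 2 h‖ ^ q) *
        ∫⁻ g, ENNReal.ofReal (‖g‖⁻¹ ^ q) ∂(stdGaussian (EuclideanSpace ℝ (Fin (p + 1)))) := by
  by_cases h0 : h = 0
  · simp [h0, hq]
  obtain ⟨i, -⟩ : ∃ i, h i ≠ 0 := Function.ne_iff.1 h0
  set c := ‖(WithLp.toLp 2 h : EuclideanSpace ℝ κ)‖ with hc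
  have hc0 : c ≠ 0 := by simpa [hc] using h0
  set e : EuclideanSpace ℝ κ := c⁻¹ • WithLp.toLp 2 h with he
  have hen : ‖e‖ = 1 := by
    rw [he, norm_smul, norm_inv, Real.norm_of_nonneg (norm_nonneg _), ← hc, inv_mul_cancel₀ hc0]
  obtain ⟨b, hb⟩ := Orthonormal.exists_orthonormalBasis_extension_of_card_eq
    (𝕜 := ℝ) (E := EuclideanSpace ℝ κ) (ι := κ) (v := fun _ => e) (s := {i}) (by simp)
    ⟨fun _ => hen, fun a b hab => (hab (Subsingleton.elim a b)).elim⟩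
  set W : Matrix κ κ ℝ := of fun a j => b a j with hWdef
  have hW : W * Wᵀ = 1 := by
    ext a a'
    have := orthonormal_iff_ite.1 b.orthonormal a' a
    rw [PiLp.inner_apply] at this
    simpa [mul_apply, hWdef, one_apply, eq_comm] using this
  have hWe : c • (Wᵀ *ᵥ Pi.single i 1) = h := by
    ext j
    have h1 : b i = e := hb i rfl
    simp [hWdef, h1, he, hc0]
  have hmeas : Measurable fun G : κ → ν → ℝ => ENNReal.ofReal
      (‖WithLp.toLp 2 (rightPinv G *ᵥ Pi.single i 1)‖ ^ q) :=
    ((measurable_norm_rightPinv_mulVec _).pow_const q).ennreal_ofReal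
  have hm : Measurable fun (G : κ → ν → ℝ) i j => (W * of G) i j := by
    simp only [mul_apply, of_apply]; fun_prop
  have hpt : ∀ G : κ → ν → ℝ, ENNReal.ofReal (‖WithLp.toLp 2 (rightPinv G *ᵥ h)‖ ^ q) =
      ENNReal.ofReal (c ^ q) * ENNReal.ofReal (‖WithLp.toLp 2
        (rightPinv (fun i j => (W * of G) i j) *ᵥ Pi.single i 1)‖ ^ q) := fun G => by
    rw [rightPinv_mul hW, ← mulVec_mulVec, ← ENNReal.ofReal_mul (by positivity), ← mul_pow]
    conv_lhs => rw [← hWe]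
    rw [mulVec_smul, WithLp.toLp_smul, norm_smul, Real.norm_of_nonneg (norm_nonneg _)]
  simp_rw [hpt]
  rw [lintegral_const_mul' _ _ ENNReal.ofReal_ne_top]
  gcongr
  refine le_trans (le_of_eq ?_) (lintegral_rightPinv_single_le hcard i q)
  conv_rhs => rw [← map_mul_gaussMat hW, lintegral_map hmeas hm]

end Resample

/-- A bound on a higher moment bounds the mean. -/
lemma lintegral_ofReal_le_of_pow {α : Type*} [MeasurableSpace α] {μ : Measure α}
    [IsProbabilityMeasure μ] {f : α → ℝ} (hf0 : ∀ x, 0 ≤ f x) {c : ℝ}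
    (hc : 0 < c) {m : ℕ} (hm : 1 ≤ m)
    (h : ∫⁻ x, ENNReal.ofReal (f x ^ m) ∂μ ≤ ENNReal.ofReal (c ^ m)) :
    ∫⁻ x, ENNReal.ofReal (f x) ∂μ ≤ ENNReal.ofReal c := by
  have hm' : (1 : ℝ) ≤ m := by exact_mod_cast hm
  set a : ℝ := c / (m * c ^ m) with ha
  have ha0 : 0 ≤ a := by positivity
  set b : ℝ := c * (1 - 1 / m) with hb
  have hb0 : 0 ≤ b := mul_nonneg hc.le (by
    rw [sub_nonneg, div_le_one (by linarith)]; exact hm')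
  have hpt : ∀ x, ENNReal.ofReal (f x) ≤
      ENNReal.ofReal b + ENNReal.ofReal a * ENNReal.ofReal (f x ^ m) := fun x => by
    rw [← ENNReal.ofReal_mul ha0, ← ENNReal.ofReal_add hb0 (mul_nonneg ha0 (pow_nonneg (hf0 x) m))]
    refine ENNReal.ofReal_le_ofReal ?_
    have h1 := one_add_mul_le_pow (a := f x / c - 1)
      (by linarith [div_nonneg (hf0 x) hc.le]) m
    rw [add_sub_cancel, div_pow, le_div_iff₀ (by positivity)] at h1
    rw [hb, ha]
    have h2 : c * (1 - 1 / m) + c / (m * c ^ m) * f x ^ m - f x =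
        c / (m * c ^ m) * (f x ^ m - (1 + m * (f x / c - 1)) * c ^ m) := by
      field_simp
      ring
    have h3 : 0 ≤ c / (m * c ^ m) * (f x ^ m - (1 + m * (f x / c - 1)) * c ^ m) :=
      mul_nonneg ha0 (sub_nonneg.2 h1)
    linarith
  refine (lintegral_mono hpt).trans ?_
  rw [lintegral_add_left measurable_const, lintegral_const, measure_univ, mul_one,
    lintegral_const_mul' _ _ ENNReal.ofReal_ne_top]
  refine (add_le_add_right (mul_le_mul_right h _) _).trans_eq ?_
  rw [← ENNReal.ofReal_mul ha0, ← ENNReal.ofReal_add hb0 (by positivity)]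
  congr 1
  rw [hb, ha]
  field_simp
  ring

lemma lintegral_abs_inner_pow_stdGaussian {κ : Type*} [Fintype κ] (w : EuclideanSpace ℝ κ) {m : ℕ}
    (hm : m ≠ 0) :
    ∫⁻ x, ENNReal.ofReal (|inner ℝ w x| ^ m) ∂(stdGaussian (EuclideanSpace ℝ κ)) =
      ENNReal.ofReal (‖w‖ ^ m) * ENNReal.ofReal (halfMoment m / halfMoment 0) := by
  by_cases hw : w = 0
  · simp [hw, hm]
  have hw0 : ‖w‖ ≠ 0 := norm_ne_zero_iff.2 hw
  set u := ‖w‖⁻¹ • w with hu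
  have hun : ‖u‖ = 1 := by rw [hu, norm_smul, norm_inv, norm_norm, inv_mul_cancel₀ hw0]
  have hwu : w = ‖w‖ • u := by rw [hu, smul_smul, mul_inv_cancel₀ hw0, one_smul]
  have hL : Measurable fun x : EuclideanSpace ℝ κ =>
    (WithLp.toLp 2 fun _ : Fin 1 => inner ℝ u x : EuclideanSpace ℝ (Fin 1)) := by fun_prop
  have hlaw := map_stdGaussian_of_inner hL (J := fun t => t 0 • u)
    (fun t => by simp [norm_smul, hun, EuclideanSpace.norm_eq, Real.sqrt_sq_eq_abs])
    (fun x t => by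
      rw [inner_smul_right, real_inner_comm u x]
      simp [PiLp.inner_apply (𝕜 := ℝ) (ι := Fin 1)])
  have h1 := lintegral_norm_pow_stdGaussian (E := EuclideanSpace ℝ (Fin 1)) (d := 0) (by simp) m
  rw [← hlaw, lintegral_map (by fun_prop) hL, zero_add] at h1
  rw [← h1, ← lintegral_const_mul' _ _ ENNReal.ofReal_ne_top]
  refine lintegral_congr fun x => ?_
  rw [← ENNReal.ofReal_mul (by positivity), ← mul_pow]
  congr 2
  conv_lhs => rw [hwu]
  rw [inner_smul_left, abs_mul]
  simp [EuclideanSpace.norm_eq, Real.sqrt_sq_eq_abs]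

section Moments

variable {κ ν : Type*} [Fintype κ] [Fintype ν] [DecidableEq κ] {p : ℕ}

lemma lintegral_frobenius_rightPinv_le (hcard : Fintype.card ν = Fintype.card κ + p) (hp : 2 ≤ p)
    [Nonempty κ] :
    ∫⁻ G, ENNReal.ofReal (√(∑ a, ∑ b, rightPinv G a b ^ 2)) ∂(gaussMat κ ν) ≤
      ENNReal.ofReal (√((Fintype.card κ : ℝ) / ((p : ℝ) - 1))) := by
  have hp' : (2 : ℝ) ≤ p := by exact_mod_cast hp
  have hk : (0 : ℝ) < Fintype.card κ := by exact_mod_cast Fintype.card_pos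
  have hkp : 0 < (Fintype.card κ : ℝ) / ((p : ℝ) - 1) := div_pos hk (by linarith)
  refine lintegral_ofReal_le_of_pow (m := 2) (fun _ => Real.sqrt_nonneg _) (Real.sqrt_pos.2 hkp)
    (by norm_num) ?_
  rw [Real.sq_sqrt hkp.le]
  have hpt : ∀ G : κ → ν → ℝ, ENNReal.ofReal (√(∑ a, ∑ b, rightPinv G a b ^ 2) ^ 2) =
      ∑ b, ENNReal.ofReal (‖WithLp.toLp 2 (rightPinv G *ᵥ Pi.single b 1)‖ ^ 2) := fun G => by
    have h0 : 0 ≤ ∑ a, ∑ b, rightPinv G a b ^ 2 :=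
      Finset.sum_nonneg fun a _ => Finset.sum_nonneg fun b _ => sq_nonneg _
    rw [Real.sq_sqrt h0, ← ENNReal.ofReal_sum_of_nonneg fun _ _ => sq_nonneg _, Finset.sum_comm]
    congr 1
    exact Finset.sum_congr rfl fun b _ => by simp [EuclideanSpace.real_norm_sq_eq]
  simp_rw [hpt]
  rw [lintegral_finsetSum _ fun b _ =>
    ((measurable_norm_rightPinv_mulVec _).pow_const 2).ennreal_ofReal]
  refine (Finset.sum_le_sum fun b _ => lintegral_rightPinv_single_le hcard b 2).trans_eq ?_
  obtain ⟨j, rfl⟩ : ∃ j, p = j + 2 := ⟨p - 2, by omega⟩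
  rw [lintegral_norm_inv_pow_stdGaussian (d := j + 2) (by simp) (by omega), Finset.sum_const,
    Finset.card_univ, nsmul_eq_mul, ← ENNReal.ofReal_natCast, ← ENNReal.ofReal_mul (by positivity)]
  congr 1
  have := halfMoment_pos j
  rw [Nat.add_sub_cancel, halfMoment_add_two]
  push_cast
  rw [show (j : ℝ) + 2 - 1 = j + 1 by ring]
  field_simp

open scoped Matrix.Norms.L2Operator

lemma measurable_l2_opNorm {α m r : Type*} [MeasurableSpace α] [Fintype m] [Fintype r]
    [DecidableEq r] {f : α → Matrix m r ℝ} (hf : ∀ i j, Measurable fun x => f x i j) :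
    Measurable fun x => ‖f x‖ := by
  have h : Continuous fun g : m → r → ℝ => ‖(of g : Matrix m r ℝ)‖ :=
    continuous_norm.comp (by exact continuous_id)
  exact h.measurable.comp (measurable_pi_lambda _ fun i => measurable_pi_lambda _ fun j => hf i j)

lemma l2_opNorm_pow_le {m r : Type*} [Fintype m] [Fintype r] [DecidableEq r] (M : Matrix m r ℝ)
    {q : ℕ} (hq : q ≠ 0) {c : ℝ} (hc : 0 ≤ c)
    (h : ∀ v : EuclideanSpace ℝ r, ‖v‖ = 1 → ‖WithLp.toLp 2 (M *ᵥ v)‖ ^ q ≤ c) : ‖M‖ ^ q ≤ c := by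
  have h1 : ‖M‖ ≤ c ^ (1 / q : ℝ) := by
    rw [l2_opNorm_def]
    refine ContinuousLinearMap.opNorm_le_of_unit_norm (by positivity) fun v hv => ?_
    change ‖(WithLp.toLp 2 (M *ᵥ v) : EuclideanSpace ℝ m)‖ ≤ _
    rw [one_div, Real.le_rpow_inv_iff_of_pos (norm_nonneg _) hc (by positivity), Real.rpow_natCast]
    exact h v hv
  rwa [one_div, Real.le_rpow_inv_iff_of_pos (norm_nonneg _) hc (by positivity),
    Real.rpow_natCast] at h1

lemma l2_opNorm_transpose {m r : Type*} [Fintype m] [Fintype r] [DecidableEq r] [DecidableEq m]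
    (M : Matrix m r ℝ) : ‖Mᵀ‖ = ‖M‖ := by
  rw [← conjTranspose_eq_transpose_of_trivial, l2_opNorm_conjTranspose]

lemma l2_opNorm_pow_mul_le [DecidableEq ν] (T : Matrix ν κ ℝ) {q : ℕ} (hq : q ≠ 0) :
    ENNReal.ofReal (‖T‖ ^ q) * ENNReal.ofReal (halfMoment q / halfMoment 0) ≤
      ∫⁻ h, ENNReal.ofReal (‖WithLp.toLp 2 (T *ᵥ h.ofLp)‖ ^ q)
        ∂(stdGaussian (EuclideanSpace ℝ κ)) := by
  set X := ∫⁻ h, ENNReal.ofReal (‖WithLp.toLp 2 (T *ᵥ h.ofLp)‖ ^ q)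
        ∂(stdGaussian (EuclideanSpace ℝ κ)) with hX
  by_cases htop : X = ⊤
  · rw [htop]; exact le_top
  have hI : 0 < halfMoment q / halfMoment 0 := div_pos (halfMoment_pos _) (halfMoment_pos _)
  have hv : ∀ v : EuclideanSpace ℝ ν, ‖v‖ = 1 →
      ENNReal.ofReal (‖WithLp.toLp 2 (Tᵀ *ᵥ v)‖ ^ q) *
        ENNReal.ofReal (halfMoment q / halfMoment 0) ≤ X := fun v hv => by
    rw [← lintegral_abs_inner_pow_stdGaussian _ hq]
    refine lintegral_mono fun h => ENNReal.ofReal_le_ofReal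
      (pow_le_pow_left₀ (abs_nonneg _) ?_ q)
    have h1 : inner ℝ (WithLp.toLp 2 (Tᵀ *ᵥ v.ofLp)) h =
        inner ℝ v (WithLp.toLp 2 (T *ᵥ h.ofLp)) := by
      have : h.ofLp ⬝ᵥ (Tᵀ *ᵥ v.ofLp) = (T *ᵥ h.ofLp) ⬝ᵥ v.ofLp := by
        rw [dotProduct_mulVec, vecMul_transpose]
      simpa [PiLp.inner_apply, dotProduct] using this
    rw [h1]
    exact (abs_real_inner_le_norm _ _).trans_eq (by rw [hv, one_mul])
  have hv' : ∀ v : EuclideanSpace ℝ ν, ‖v‖ = 1 →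
      ‖WithLp.toLp 2 (Tᵀ *ᵥ v)‖ ^ q ≤ X.toReal / (halfMoment q / halfMoment 0) := fun v h => by
    rw [le_div_iff₀ hI, ← ENNReal.ofReal_le_iff_le_toReal htop, ENNReal.ofReal_mul (by positivity)]
    exact hv v h
  have h2 := l2_opNorm_pow_le Tᵀ hq (by positivity) hv'
  rw [l2_opNorm_transpose, le_div_iff₀ hI, ← ENNReal.ofReal_le_iff_le_toReal htop,
    ENNReal.ofReal_mul (by positivity)] at h2
  exact h2

lemma lintegral_l2_opNorm_rightPinv_le [DecidableEq ν]
    (hcard : Fintype.card ν = Fintype.card κ + p) (hp : 1 ≤ p) [Nonempty κ] :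
    ∫⁻ G, ENNReal.ofReal ‖rightPinv G‖ ∂(gaussMat κ ν) ≤
      ENNReal.ofReal (Real.exp 1 * √((Fintype.card κ : ℝ) + p) / p) := by
  have hp0 : p ≠ 0 := by omega
  have hp' : (0 : ℝ) < p := by exact_mod_cast hp
  set k := Fintype.card κ
  obtain ⟨d, hd⟩ : ∃ d, k = d + 1 := ⟨k - 1, by have : 0 < k := Fintype.card_pos; omega⟩
  set J := halfMoment p / halfMoment 0 with hJ
  have hJ0 : 0 < J := div_pos (halfMoment_pos _) (halfMoment_pos _)
  refine lintegral_ofReal_le_of_pow (fun _ => norm_nonneg _) (by positivity) hp ?_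
  have hjoint : Measurable fun z : (κ → ν → ℝ) × EuclideanSpace ℝ κ =>
      ENNReal.ofReal (‖WithLp.toLp 2 (rightPinv z.1 *ᵥ z.2.ofLp)‖ ^ p) := by
    refine (Measurable.pow_const ?_ p).ennreal_ofReal
    refine ((WithLp.measurable_toLp 2 _).comp (measurable_pi_lambda _ fun a => ?_)).norm
    simp only [mulVec, dotProduct]
    exact Finset.measurable_fun_sum _ fun b _ =>
      ((measurable_rightPinv_apply a b).comp measurable_fst).mul (by fun_prop)
  have h1 : (∫⁻ G, ENNReal.ofReal (‖rightPinv G‖ ^ p) ∂(gaussMat κ ν)) * ENNReal.ofReal J ≤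
      ENNReal.ofReal (√(k + p) ^ p) * ENNReal.ofReal J⁻¹ := by
    calc _ = ∫⁻ G, ENNReal.ofReal (‖rightPinv G‖ ^ p) * ENNReal.ofReal J ∂(gaussMat κ ν) := by
          rw [lintegral_mul_const' _ _ ENNReal.ofReal_ne_top]
      _ ≤ ∫⁻ G, ∫⁻ h, ENNReal.ofReal (‖WithLp.toLp 2 (rightPinv G *ᵥ h.ofLp)‖ ^ p)
            ∂(stdGaussian (EuclideanSpace ℝ κ)) ∂(gaussMat κ ν) :=
          lintegral_mono fun G => l2_opNorm_pow_mul_le _ hp0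
      _ = ∫⁻ h, ∫⁻ G, ENNReal.ofReal (‖WithLp.toLp 2 (rightPinv G *ᵥ h.ofLp)‖ ^ p)
            ∂(gaussMat κ ν) ∂(stdGaussian (EuclideanSpace ℝ κ)) :=
          lintegral_lintegral_swap hjoint.aemeasurable
      _ ≤ ∫⁻ h, ENNReal.ofReal (‖h‖ ^ p) * ENNReal.ofReal J⁻¹
            ∂(stdGaussian (EuclideanSpace ℝ κ)) := by
          refine lintegral_mono fun h => (lintegral_rightPinv_mulVec_le hcard _ hp0).trans_eq ?_
          rw [lintegral_norm_inv_pow_stdGaussian (d := p) (by simp) le_rfl, Nat.sub_self, hJ,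
            inv_div]
      _ ≤ _ := by
          rw [lintegral_mul_const' _ _ ENNReal.ofReal_ne_top,
            lintegral_norm_pow_stdGaussian (d := d) (by simpa using hd)]
          gcongr
          rw [div_le_iff₀ (halfMoment_pos _)]
          refine (halfMoment_add_le d p).trans ?_
          have := halfMoment_pos d
          gcongr
          rw [hd]; linarith
  have h2 : ENNReal.ofReal (√(k + p) ^ p) * ENNReal.ofReal J⁻¹ ≤
      ENNReal.ofReal ((Real.exp 1 * √((k : ℝ) + p) / p) ^ p) * ENNReal.ofReal J := by
    rw [← ENNReal.ofReal_mul (by positivity), ← ENNReal.ofReal_mul (by positivity)]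
    refine ENNReal.ofReal_le_ofReal ?_
    rw [← div_eq_mul_inv, div_le_iff₀ hJ0]
    have h3 := le_halfMoment_ratio_sq p hp
    have h4 : (Real.exp 1 * √((k : ℝ) + p) / p) ^ p * (p / Real.exp 1) ^ p = √(k + p) ^ p := by
      rw [← mul_pow]; congr 1; field_simp
    rw [← h4, mul_assoc, ← pow_two]
    gcongr
  exact (ENNReal.mul_le_mul_iff_left (by simpa using hJ0) ENNReal.ofReal_ne_top).1 (h1.trans h2)

end Moments

section Deterministic

open scoped Matrix.Norms.L2Operator

variable {ι ν : Type*} [Fintype ι] [Fintype ν]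

lemma vecNorm2R_eq_norm (x : ι → ℝ) : vecNorm2R x = ‖WithLp.toLp 2 x‖ := by
  simp [vecNorm2R, EuclideanSpace.norm_eq]

lemma specNormR_nonneg (M : Matrix ι ν ℝ) : 0 ≤ specNormR M :=
  Real.sSup_nonneg fun _ ⟨_, _, h⟩ => h ▸ div_nonneg (Real.sqrt_nonneg _) (Real.sqrt_nonneg _)

lemma matBnormR_nonneg (B M : Matrix ι ι ℝ) : 0 ≤ matBnormR B M :=
  Real.sSup_nonneg fun _ ⟨_, _, h⟩ => h ▸ div_nonneg (Real.sqrt_nonneg _) (Real.sqrt_nonneg _)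

lemma norm_mulVec_le_specNormR [DecidableEq ν] (M : Matrix ι ν ℝ) (x : ν → ℝ) :
    ‖WithLp.toLp 2 (M *ᵥ x)‖ ≤ specNormR M * ‖WithLp.toLp 2 x‖ := by
  by_cases hx : x = 0
  · simp [hx]
  have hx0 : 0 < ‖(WithLp.toLp 2 x : EuclideanSpace ℝ ν)‖ := norm_pos_iff.2 (by simpa using hx)
  rw [← div_le_iff₀ hx0]
  refine le_csSup ⟨‖M‖, ?_⟩ ⟨x, hx, by rw [vecNorm2R_eq_norm, vecNorm2R_eq_norm]⟩
  rintro _ ⟨y, hy, rfl⟩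
  have hy0 : 0 < ‖(WithLp.toLp 2 y : EuclideanSpace ℝ ν)‖ := norm_pos_iff.2 (by simpa using hy)
  rw [vecNorm2R_eq_norm, vecNorm2R_eq_norm, div_le_iff₀ hy0]
  exact l2_opNorm_toLp_mulVec_le M y

lemma norm_toLp_mulVec_of_orthogonal [DecidableEq ι] {W : Matrix ι ι ℝ} (hW : W * Wᵀ = 1) (x : ι → ℝ) :
    ‖WithLp.toLp 2 (W *ᵥ x)‖ = ‖WithLp.toLp 2 x‖ := by
  rw [← sq_eq_sq₀ (norm_nonneg _) (norm_nonneg _), norm_toLp_sq, norm_toLp_sq,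
    dotProduct_mulVec, ← mulVec_transpose, mulVec_mulVec, mul_eq_one_comm.1 hW, one_mulVec]

variable {B S : Matrix ι ι ℝ}

lemma vecBnormR_eq_norm (hS : S.IsSymm) (hSS : S * S = B) (x : ι → ℝ) :
    vecBnormR B x = ‖WithLp.toLp 2 (S *ᵥ x)‖ := by
  rw [vecBnormR, ← hSS, ← mulVec_mulVec, dotProduct_mulVec, ← mulVec_transpose, hS.eq,
    ← norm_toLp_sq, Real.sqrt_sq (norm_nonneg _)]

/-- The `B`-orthogonal projection realizes the smallest `B`-distance. -/
lemma vecBnormR_sub_proj_le (hB : B.IsSymm) (hS : S.IsSymm) (hSS : S * S = B)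
    {P : Matrix ι ι ℝ} (hP : P * P = P) (hPB : (B * P).IsSymm) (a : ι → ℝ) {z : ι → ℝ}
    (hz : P *ᵥ z = z) :
    vecBnormR B (a - P *ᵥ a) ≤ ‖WithLp.toLp 2 (S *ᵥ (a - z))‖ := by
  set w := a - P *ᵥ a with hw
  set u := P *ᵥ (a - z) with hu
  have haz : a - z = w + u := by rw [hw, hu, mulVec_sub, hz]; abel
  have horth : (S *ᵥ w) ⬝ᵥ (S *ᵥ u) = 0 := by
    have h1 : (S *ᵥ w) ⬝ᵥ (S *ᵥ u) = w ⬝ᵥ (B *ᵥ u) := by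
      rw [← hSS, ← mulVec_mulVec, dotProduct_mulVec w, ← mulVec_transpose, hS.eq]
    have h2 : Pᵀ * (B * P) = B * P := by
      have h3 : Pᵀ * B = B * P := by
        have := hPB.eq
        rwa [transpose_mul, hB.eq] at this
      rw [← Matrix.mul_assoc, h3, Matrix.mul_assoc, hP]
    have h4 : (P *ᵥ a) ⬝ᵥ ((B * P) *ᵥ (a - z)) = a ⬝ᵥ ((B * P) *ᵥ (a - z)) := by
      conv_rhs => rw [← h2, ← mulVec_mulVec, dotProduct_mulVec a, vecMul_transpose]
    rw [h1, hu, mulVec_mulVec, hw, sub_dotProduct, h4, sub_self]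
  rw [vecBnormR_eq_norm hS hSS, haz, ← sq_le_sq₀ (norm_nonneg _) (norm_nonneg _), norm_toLp_sq,
    norm_toLp_sq, mulVec_add, add_dotProduct, dotProduct_add, dotProduct_add, horth,
    dotProduct_comm (S *ᵥ u) (S *ᵥ w), horth]
  have : 0 ≤ (S *ᵥ u) ⬝ᵥ (S *ᵥ u) := by rw [← norm_toLp_sq]; positivity
  linarith

lemma norm_le_sqrt_specNormR_mul [DecidableEq ι] (hS : S.PosDef) (hSsym : S.IsSymm) (hSS : S * S = B) (x : ι → ℝ) :
    ‖WithLp.toLp 2 x‖ ≤ √(specNormR B⁻¹) * ‖WithLp.toLp 2 (S *ᵥ x)‖ := by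
  have hdet : IsUnit S.det := hS.det_pos.ne'.isUnit
  rw [← sq_le_sq₀ (norm_nonneg _) (by positivity), mul_pow, Real.sq_sqrt (specNormR_nonneg _)]
  set z := S *ᵥ x with hz
  have h1 : B⁻¹ *ᵥ z = S⁻¹ *ᵥ x := by
    rw [hz, ← hSS, Matrix.mul_inv_rev, mulVec_mulVec, Matrix.mul_assoc,
      Matrix.nonsing_inv_mul _ hdet, Matrix.mul_one]
  have h2 : z ⬝ᵥ (B⁻¹ *ᵥ z) = x ⬝ᵥ x := by
    rw [h1, hz, ← hSsym.eq, mulVec_transpose, ← dotProduct_mulVec, mulVec_mulVec, hSsym.eq,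
      Matrix.mul_nonsing_inv _ hdet, one_mulVec]
  have h3 := dotProduct_le_norm_mul_norm z (B⁻¹ *ᵥ z)
  have h4 := norm_mulVec_le_specNormR B⁻¹ z
  rw [norm_toLp_sq, ← h2]
  calc _ ≤ _ := h3
    _ ≤ ‖WithLp.toLp 2 z‖ * (specNormR B⁻¹ * ‖WithLp.toLp 2 z‖) := by gcongr
    _ = _ := by ring

variable [DecidableEq ι] {pr : ι → Prop} [DecidablePred pr]

/-- The contribution of the trailing singular values to the range finder error. -/
def tailMatrix (pr : ι → Prop) [DecidablePred pr] (σ : ι → ℝ) (G₁ : {i // pr i} → ν → ℝ)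
    (G₂ : {i // ¬ pr i} → ν → ℝ) : Matrix {i // ¬ pr i} {i // pr i} ℝ :=
  diagonal (fun i : {i // ¬ pr i} => σ i) * of G₂ * rightPinv G₁

lemma norm_diagonal_mulVec_sub_le {σ : ι → ℝ} {c : ℝ} (hσ0 : ∀ i, 0 ≤ σ i) (hc : 0 ≤ c)
    (hσ : ∀ i, ¬ pr i → σ i ≤ c) (G : ι → ν → ℝ)
    (hG : LinearIndependent ℝ fun i : {i // pr i} => G i) (x : ι → ℝ) :
    ‖WithLp.toLp 2 (diagonal σ *ᵥ (x - of G *ᵥ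
        (rightPinv (fun i : {i // pr i} => G i) *ᵥ fun i : {i // pr i} => x i)))‖ ≤
      (c + ‖tailMatrix pr σ (fun i => G i) (fun i => G i)‖) * ‖WithLp.toLp 2 x‖ := by
  set T := rightPinv (fun i : {i // pr i} => G i) with hT
  set x₁ : {i // pr i} → ℝ := fun i => x i with hx₁
  set x₂ : {i // ¬ pr i} → ℝ := fun i => x i with hx₂
  set Z := tailMatrix pr σ (fun i => G i) (fun i => G i) with hZ
  set y := diagonal σ *ᵥ (x - of G *ᵥ (T *ᵥ x₁)) with hy
  have hnorm : ∀ z : ι → ℝ, ‖WithLp.toLp 2 z‖ ^ 2 =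
      ‖WithLp.toLp 2 fun i : {i // pr i} => z i‖ ^ 2 +
        ‖WithLp.toLp 2 fun i : {i // ¬ pr i} => z i‖ ^ 2 := fun z => by
    simp only [EuclideanSpace.real_norm_sq_eq]
    exact (Fintype.sum_subtype_add_sum_subtype pr fun i => z i ^ 2).symm
  have hy₁ : (fun i : {i // pr i} => y i) = 0 := by
    ext i
    have h1 : of (fun i : {i // pr i} => G i) *ᵥ (T *ᵥ x₁) = x₁ := by
      rw [mulVec_mulVec, of_mul_rightPinv hG, one_mulVec]
    have h2 : (of G *ᵥ (T *ᵥ x₁)) i = x i := congrFun h1 i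
    simp only [hy, mulVec_diagonal, Pi.sub_apply, h2, sub_self, mul_zero, Pi.zero_apply]
  have hy₂ : (fun i : {i // ¬ pr i} => y i) =
      diagonal (fun i : {i // ¬ pr i} => σ i) *ᵥ x₂ - Z *ᵥ x₁ := by
    ext i
    rw [hZ, tailMatrix, ← mulVec_mulVec, ← mulVec_mulVec]
    simp only [hy, Pi.sub_apply, mulVec_diagonal, mul_sub]
    rfl
  have hyn : ‖WithLp.toLp 2 y‖ = ‖WithLp.toLp 2 fun i : {i // ¬ pr i} => y i‖ := by
    rw [← sq_eq_sq₀ (norm_nonneg _) (norm_nonneg _), hnorm y, hy₁]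
    simp
  have hle₁ : ‖WithLp.toLp 2 x₁‖ ≤ ‖WithLp.toLp 2 x‖ := by
    rw [← sq_le_sq₀ (norm_nonneg _) (norm_nonneg _), hnorm x]
    exact le_add_of_nonneg_right (sq_nonneg _)
  have hle₂ : ‖WithLp.toLp 2 x₂‖ ≤ ‖WithLp.toLp 2 x‖ := by
    rw [← sq_le_sq₀ (norm_nonneg _) (norm_nonneg _), hnorm x]
    exact le_add_of_nonneg_left (sq_nonneg _)
  have hD : ‖WithLp.toLp 2 (diagonal (fun i : {i // ¬ pr i} => σ i) *ᵥ x₂)‖ ≤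
      c * ‖WithLp.toLp 2 x₂‖ := by
    rw [← sq_le_sq₀ (norm_nonneg _) (by positivity), mul_pow, EuclideanSpace.real_norm_sq_eq,
      EuclideanSpace.real_norm_sq_eq, Finset.mul_sum]
    refine Finset.sum_le_sum fun i _ => ?_
    simp only [mulVec_diagonal, mul_pow]
    gcongr
    · exact hσ0 _
    · exact hσ _ i.2
  rw [hyn, hy₂, WithLp.toLp_sub, add_mul]
  refine (norm_sub_le _ _).trans (add_le_add (hD.trans ?_) ((l2_opNorm_toLp_mulVec_le _ _).trans ?_))
  · gcongr
  · gcongr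

/-- Deterministic error bound for the randomized range finder. -/
theorem matBnormR_range_finder_le (hB : B.IsSymm) (hS : S.PosDef) (hSsym : S.IsSymm)
    (hSS : S * S = B) {σ : ι → ℝ} {c : ℝ} (hσ0 : ∀ i, 0 ≤ σ i) (hc : 0 ≤ c)
    (hσ : ∀ i, ¬ pr i → σ i ≤ c) {C U V P : Matrix ι ι ℝ} (hU : U * Uᵀ = 1) (hV : V * Vᵀ = 1)
    (hsvd : S * C = U * diagonal σ * Vᵀ) (Ω : Matrix ι ν ℝ) (hP : P * P = P)
    (hPrange : LinearMap.range P.mulVecLin = LinearMap.range (C * Ω).mulVecLin)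
    (hPsym : (B * P).IsSymm)
    (hG : LinearIndependent ℝ fun i : {i // pr i} => (Vᵀ * Ω) i) :
    matBnormR B ((1 - P) * C) ≤ √(specNormR B⁻¹) *
      (c + ‖tailMatrix pr σ (fun i j => (Vᵀ * Ω) i j) (fun i j => (Vᵀ * Ω) i j)‖) := by
  set Z := tailMatrix pr σ (fun i j => (Vᵀ * Ω) i j) (fun i j => (Vᵀ * Ω) i j) with hZ
  refine Real.sSup_le ?_ (by positivity)
  rintro _ ⟨x, hx, rfl⟩
  have hx0 : 0 < ‖(WithLp.toLp 2 x : EuclideanSpace ℝ ι)‖ := norm_pos_iff.2 (by simpa using hx)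
  have hspec := norm_le_sqrt_specNormR_mul hS hSsym hSS x
  have hSx : 0 < ‖(WithLp.toLp 2 (S *ᵥ x) : EuclideanSpace ℝ ι)‖ := by
    by_contra h
    have : ‖(WithLp.toLp 2 (S *ᵥ x) : EuclideanSpace ℝ ι)‖ = 0 :=
      le_antisymm (not_lt.1 h) (norm_nonneg _)
    rw [this, mul_zero] at hspec
    linarith
  rw [vecBnormR_eq_norm hSsym hSS x, div_le_iff₀ hSx]
  set G : ι → ν → ℝ := fun i j => (Vᵀ * Ω) i j with hGdef
  set ξ := Vᵀ *ᵥ x with hξ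
  set y := rightPinv (fun i : {i // pr i} => G i) *ᵥ fun i : {i // pr i} => ξ i with hy
  have hPz : P *ᵥ ((C * Ω) *ᵥ y) = (C * Ω) *ᵥ y := by
    obtain ⟨b, hb⟩ : (C * Ω) *ᵥ y ∈ LinearMap.range P.mulVecLin := by
      rw [hPrange]; exact ⟨y, rfl⟩
    rw [← hb, mulVecLin_apply, mulVec_mulVec, hP]
  have h1 := vecBnormR_sub_proj_le hB hSsym hSS hP hPsym (C *ᵥ x) hPz
  have h2 (y : ν → ℝ) :
      S *ᵥ (C *ᵥ x - (C * Ω) *ᵥ y) = U *ᵥ (diagonal σ *ᵥ (ξ - of G *ᵥ y)) := by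
    have h3 : of G *ᵥ y = Vᵀ *ᵥ (Ω *ᵥ y) := (mulVec_mulVec y Vᵀ Ω).symm
    rw [h3, hξ, ← mulVec_sub, mulVec_mulVec, mulVec_mulVec, ← hsvd,
      ← mulVec_mulVec y C, ← mulVec_sub, mulVec_mulVec]
  rw [h2, norm_toLp_mulVec_of_orthogonal hU] at h1
  have h4 := norm_diagonal_mulVec_sub_le hσ0 hc hσ G hG ξ
  have h5 : ‖WithLp.toLp 2 ξ‖ = ‖WithLp.toLp 2 x‖ :=
    norm_toLp_mulVec_of_orthogonal (by rw [transpose_transpose]; exact mul_eq_one_comm.1 hV) x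
  rw [h5] at h4
  have h6 : ((1 - P) * C) *ᵥ x = C *ᵥ x - P *ᵥ (C *ᵥ x) := by
    rw [← mulVec_mulVec, sub_mulVec, one_mulVec]
  rw [h6]
  calc _ ≤ _ := h1
    _ ≤ _ := h4
    _ ≤ (c + ‖Z‖) * (√(specNormR B⁻¹) * ‖WithLp.toLp 2 (S *ᵥ x)‖) := by gcongr
    _ = _ := by ring

end Deterministic

section Expectation

open scoped Matrix.Norms.L2Operator

variable {ι ν : Type*} [Fintype ι] [Fintype ν] {pr : ι → Prop} [DecidablePred pr]

lemma measurePreserving_split_gaussMat (pr : ι → Prop) [DecidablePred pr] :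
    MeasurePreserving (MeasurableEquiv.piEquivPiSubtypeProd (fun _ : ι => ν → ℝ) pr)
      (gaussMat ι ν) ((gaussMat {i // pr i} ν).prod (gaussMat {i // ¬ pr i} ν)) :=
  measurePreserving_piEquivPiSubtypeProd (fun _ : ι => Measure.pi fun _ : ν => gaussianReal 0 1) pr

variable [DecidableEq ι]

lemma measurable_norm_tailMatrix (σ : ι → ℝ) :
    Measurable fun G : ({i // pr i} → ν → ℝ) × ({i // ¬ pr i} → ν → ℝ) =>
      ‖tailMatrix pr σ G.1 G.2‖ := by
  refine measurable_l2_opNorm fun i j => ?_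
  change Measurable fun G : ({i // pr i} → ν → ℝ) × ({i // ¬ pr i} → ν → ℝ) => ∑ a,
    (diagonal (fun i : {i // ¬ pr i} => σ i) * of G.2) i a * rightPinv G.1 a j
  simp only [diagonal_mul, of_apply]
  exact Finset.measurable_sum _ fun a _ => (by fun_prop : Measurable fun G :
    ({i // pr i} → ν → ℝ) × ({i // ¬ pr i} → ν → ℝ) => σ i * G.2 i a).mul
      ((measurable_rightPinv_apply a j).comp measurable_fst)

lemma lintegral_norm_tailMatrix_le_of_fst {σ : ι → ℝ} {c : ℝ} (hσ0 : ∀ i, 0 ≤ σ i) (hc : 0 ≤ c)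
    (hσ : ∀ i, ¬ pr i → σ i ≤ c) (G₁ : {i // pr i} → ν → ℝ) :
    ∫⁻ G₂, ENNReal.ofReal ‖tailMatrix pr σ G₁ G₂‖ ∂(gaussMat {i // ¬ pr i} ν) ≤
      ENNReal.ofReal (c * √(∑ a, ∑ b, rightPinv G₁ a b ^ 2) +
        √(∑ i : {i // ¬ pr i}, σ i ^ 2) * ‖rightPinv G₁‖) := by
  refine (lintegral_l2_opNorm_le _ _).trans (ENNReal.ofReal_le_ofReal ?_)
  have hsum : ∑ i : {i // ¬ pr i}, ∑ j, diagonal (fun i : {i // ¬ pr i} => σ i) i j ^ 2 =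
      ∑ i : {i // ¬ pr i}, σ i ^ 2 :=
    Finset.sum_congr rfl fun i _ => by
      rw [Finset.sum_eq_single i (fun j _ hj => by simp [diagonal_apply_ne' _ hj]) (by simp)]
      simp
  rw [hsum]
  gcongr
  rw [l2_opNorm_diagonal, pi_norm_le_iff_of_nonneg hc]
  exact fun i => by rw [Real.norm_of_nonneg (hσ0 _)]; exact hσ _ i.2

theorem lintegral_norm_tailMatrix_le {σ : ι → ℝ} {c : ℝ} (hσ0 : ∀ i, 0 ≤ σ i) (hc : 0 ≤ c)
    (hσ : ∀ i, ¬ pr i → σ i ≤ c) [Nonempty {i // pr i}] {p : ℕ}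
    (hcard : Fintype.card ν = Fintype.card {i // pr i} + p) (hp : 2 ≤ p) :
    ∫⁻ G, ENNReal.ofReal ‖tailMatrix pr σ (fun i => G i) (fun i => G i)‖ ∂(gaussMat ι ν) ≤
      ENNReal.ofReal (c * √((Fintype.card {i // pr i} : ℝ) / ((p : ℝ) - 1)) +
        √(∑ i : {i // ¬ pr i}, σ i ^ 2) *
          (Real.exp 1 * √((Fintype.card {i // pr i} : ℝ) + p) / p)) := by
  classical
  have hp1 : (0 : ℝ) ≤ (p : ℝ) - 1 := by
    have : (2 : ℝ) ≤ p := by exact_mod_cast hp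
    linarith
  set τ := √(∑ i : {i // ¬ pr i}, σ i ^ 2) with hτ
  have hτ0 : 0 ≤ τ := Real.sqrt_nonneg _
  have hmeas := (measurable_norm_tailMatrix (ν := ν) (pr := pr) σ).ennreal_ofReal
  have hsplit := (measurePreserving_split_gaussMat (ν := ν) pr).lintegral_comp hmeas
  have hmF : Measurable fun G : {i // pr i} → ν → ℝ =>
      ENNReal.ofReal (√(∑ a, ∑ b, rightPinv G a b ^ 2)) := by
    refine (Real.continuous_sqrt.measurable.comp ?_).ennreal_ofReal
    exact Finset.measurable_sum _ fun a _ => Finset.measurable_sum _ fun b _ =>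
      (measurable_rightPinv_apply a b).pow_const 2
  calc _ = ∫⁻ G, ENNReal.ofReal ‖tailMatrix pr σ G.1 G.2‖
        ∂((gaussMat {i // pr i} ν).prod (gaussMat {i // ¬ pr i} ν)) := hsplit
    _ = ∫⁻ G₁, ∫⁻ G₂, ENNReal.ofReal ‖tailMatrix pr σ G₁ G₂‖ ∂(gaussMat {i // ¬ pr i} ν)
        ∂(gaussMat {i // pr i} ν) := lintegral_prod _ hmeas.aemeasurable
    _ ≤ ∫⁻ G₁, (ENNReal.ofReal c * ENNReal.ofReal (√(∑ a, ∑ b, rightPinv G₁ a b ^ 2)) +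
          ENNReal.ofReal τ * ENNReal.ofReal ‖rightPinv G₁‖) ∂(gaussMat {i // pr i} ν) := by
        refine lintegral_mono fun G₁ =>
          (lintegral_norm_tailMatrix_le_of_fst hσ0 hc hσ G₁).trans_eq ?_
        rw [ENNReal.ofReal_add (by positivity) (by positivity), ENNReal.ofReal_mul hc,
          ENNReal.ofReal_mul hτ0]
    _ ≤ _ := by
        rw [lintegral_add_left (hmF.const_mul _), lintegral_const_mul' _ _ ENNReal.ofReal_ne_top,
          lintegral_const_mul' _ _ ENNReal.ofReal_ne_top,
          ENNReal.ofReal_add (by positivity) (by positivity), ENNReal.ofReal_mul hc,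
          ENNReal.ofReal_mul hτ0]
        gcongr
        · exact lintegral_frobenius_rightPinv_le hcard hp
        · exact lintegral_l2_opNorm_rightPinv_le hcard (by omega)

/-- Average error bound for the randomized range finder, in terms of the projections produced by
a Gaussian test matrix. -/
theorem integral_matBnormR_range_finder_le {B S : Matrix ι ι ℝ} (hB : B.IsSymm) (hS : S.PosDef)
    (hSsym : S.IsSymm) (hSS : S * S = B) {σ : ι → ℝ} {c : ℝ} (hσ0 : ∀ i, 0 ≤ σ i) (hc : 0 ≤ c)
    (hσ : ∀ i, ¬ pr i → σ i ≤ c) {C U V : Matrix ι ι ℝ} (hU : U * Uᵀ = 1) (hV : V * Vᵀ = 1)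
    (hsvd : S * C = U * diagonal σ * Vᵀ) {P : Matrix ι ν ℝ → Matrix ι ι ℝ}
    (hP : ∀ Ω, P Ω * P Ω = P Ω)
    (hPrange : ∀ Ω, LinearMap.range (P Ω).mulVecLin = LinearMap.range (C * Ω).mulVecLin)
    (hPsym : ∀ Ω, (B * P Ω).IsSymm) [Nonempty {i // pr i}] {p : ℕ}
    (hcard : Fintype.card ν = Fintype.card {i // pr i} + p) (hp : 2 ≤ p) :
    ∫ Ω, matBnormR B ((1 - P (of Ω)) * C) ∂(gaussMat ι ν) ≤ √(specNormR B⁻¹) *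
      (c + (c * √((Fintype.card {i // pr i} : ℝ) / ((p : ℝ) - 1)) +
        √(∑ i : {i // ¬ pr i}, σ i ^ 2) *
          (Real.exp 1 * √((Fintype.card {i // pr i} : ℝ) + p) / p))) := by
  have hp1 : (0 : ℝ) ≤ (p : ℝ) - 1 := by
    have : (2 : ℝ) ≤ p := by exact_mod_cast hp
    linarith
  set F : (ι → ν → ℝ) → ℝ := fun Ω => matBnormR B ((1 - P (of Ω)) * C) with hF
  have hF0 : ∀ Ω, 0 ≤ F Ω := fun Ω => matBnormR_nonneg _ _
  by_cases hint : Integrable F (gaussMat ι ν)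
  swap
  · rw [integral_undef hint]
    positivity
  set f : (ι → ν → ℝ) → ℝ := fun G => ‖tailMatrix pr σ (fun i => G i) (fun i => G i)‖ with hf
  have hfm : Measurable f :=
    (measurable_norm_tailMatrix (pr := pr) σ).comp
      (g := fun G : ({i // pr i} → ν → ℝ) × ({i // ¬ pr i} → ν → ℝ) => ‖tailMatrix pr σ G.1 G.2‖)
      (f := fun G : ι → ν → ℝ => (fun i : {i // pr i} => G i, fun i : {i // ¬ pr i} => G i))
      (by fun_prop)
  set rot : (ι → ν → ℝ) → ι → ν → ℝ := fun Ω i j => (Vᵀ * of Ω) i j with hrot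
  have hrotmp : MeasurePreserving rot (gaussMat ι ν) (gaussMat ι ν) :=
    ⟨by simp only [hrot, mul_apply, of_apply]; fun_prop,
      map_mul_gaussMat (by rw [transpose_transpose]; exact mul_eq_one_comm.1 hV)⟩
  have hLI : ∀ᵐ Ω ∂(gaussMat ι ν), LinearIndependent ℝ fun i : {i // pr i} => rot Ω i := by
    have h1 : ∀ᵐ G ∂(gaussMat {i // pr i} ν), LinearIndependent ℝ G :=
      ae_linearIndependent_gaussMat (by omega)
    have h2 := (measurePreserving_fst.comp (measurePreserving_split_gaussMat (ν := ν) pr)).comp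
      hrotmp
    exact h2.quasiMeasurePreserving.ae h1
  rw [← ENNReal.ofReal_le_ofReal_iff (by positivity),
    ofReal_integral_eq_lintegral_ofReal hint (ae_of_all _ hF0)]
  calc ∫⁻ Ω, ENNReal.ofReal (F Ω) ∂(gaussMat ι ν)
      ≤ ∫⁻ Ω, ENNReal.ofReal √(specNormR B⁻¹) *
          (ENNReal.ofReal c + ENNReal.ofReal (f (rot Ω))) ∂(gaussMat ι ν) := by
        refine lintegral_mono_ae (hLI.mono fun Ω hΩ => ?_)
        rw [← ENNReal.ofReal_add hc (norm_nonneg _), ← ENNReal.ofReal_mul (Real.sqrt_nonneg _)]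
        exact ENNReal.ofReal_le_ofReal (matBnormR_range_finder_le hB hS hSsym hSS hσ0 hc hσ hU hV
          hsvd (of Ω) (hP _) (hPrange _) (hPsym _) hΩ)
    _ = ENNReal.ofReal √(specNormR B⁻¹) *
          (ENNReal.ofReal c + ∫⁻ G, ENNReal.ofReal (f G) ∂(gaussMat ι ν)) := by
        rw [lintegral_const_mul' _ _ ENNReal.ofReal_ne_top, lintegral_add_left measurable_const,
          lintegral_const, measure_univ, mul_one, hrotmp.lintegral_comp hfm.ennreal_ofReal]
    _ ≤ _ := by
        rw [ENNReal.ofReal_mul (Real.sqrt_nonneg _), ENNReal.ofReal_add hc (by positivity)]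
        gcongr
        exact lintegral_norm_tailMatrix_le hσ0 hc hσ hcard hp

end Expectation

/-- average spectral error bound for the randomized range finder.
    σ : Fin n → ℝ are the generalized singular values of C = B⁻¹A (the singular values
    of B^{1/2}C, given via an SVD of S*C with S = B^{1/2}), in decreasing order;
    P Ω is the B-orthogonal projector onto the column space of CΩ;
    Ω has i.i.d. standard Gaussian entries. -/
theorem statement10 {n k p : ℕ} (hk : 2 ≤ k) (hp : 2 ≤ p) (hkpn : k + p ≤ n)
    (A B : Matrix (Fin n) (Fin n) ℝ) (hA : A.IsSymm) (hB : B.PosDef)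
    (S : Matrix (Fin n) (Fin n) ℝ) (hS : S.PosDef) (hSsym : S.IsSymm) (hSS : S * S = B)
    (σ : Fin n → ℝ) (hσ0 : ∀ i, 0 ≤ σ i) (hσdec : Antitone σ)
    (Usvd Vsvd : Matrix (Fin n) (Fin n) ℝ)
    (hU : Usvd * Usvdᵀ = 1) (hV : Vsvd * Vsvdᵀ = 1)
    (hsvd : S * (B⁻¹ * A) = Usvd * Matrix.diagonal σ * Vsvdᵀ)
    (P : Matrix (Fin n) (Fin (k + p)) ℝ → Matrix (Fin n) (Fin n) ℝ)
    (hPproj : ∀ Ω, P Ω * P Ω = P Ω)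
    (hPrange : ∀ Ω, LinearMap.range (P Ω).mulVecLin =
        LinearMap.range ((B⁻¹ * A) * Ω).mulVecLin)
    (hPsym : ∀ Ω, (B * P Ω).IsSymm) :
    (∫ ω : Fin n → Fin (k + p) → ℝ,
        matBnormR B ((1 - P (Matrix.of ω)) * (B⁻¹ * A))
        ∂(Measure.pi fun _ : Fin n => Measure.pi fun _ : Fin (k + p) => gaussianReal 0 1)) ≤
      Real.sqrt (specNormR B⁻¹) *
        ((1 + Real.sqrt ((k : ℝ) / ((p : ℝ) - 1))) * σ ⟨k, by omega⟩ +
          (Real.exp 1 * Real.sqrt ((k : ℝ) + (p : ℝ)) / (p : ℝ)) *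
            Real.sqrt (∑ j : Fin n, if k ≤ (j : ℕ) then σ j ^ 2 else 0)) := by
  have hcard : Fintype.card {i : Fin n // (i : ℕ) < k} = k := by
    rw [Fintype.card_subtype, Fin.card_filter_val_lt]
    omega
  have : Nonempty {i : Fin n // (i : ℕ) < k} := ⟨⟨⟨0, by omega⟩, by simp; omega⟩⟩
  have hsum : ∑ i : {i : Fin n // ¬ (i : ℕ) < k}, σ i ^ 2 =
      ∑ j : Fin n, if k ≤ (j : ℕ) then σ j ^ 2 else 0 := by
    rw [← Finset.sum_filter]
    exact (Finset.sum_subtype _ (by simp) fun j => σ j ^ 2).symm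
  have hBsym : B.IsSymm := by simpa [conjTranspose] using hB.isHermitian
  have h := integral_matBnormR_range_finder_le (ν := Fin (k + p))
    (pr := fun i : Fin n => (i : ℕ) < k) hBsym hS hSsym hSS hσ0
    (hσ0 ⟨k, by omega⟩) (fun i hi => hσdec (Fin.mk_le_of_le_val (not_lt.1 hi))) hU hV hsvd
    hPproj hPrange hPsym (p := p) (by rw [hcard, Fintype.card_fin]) hp
  rw [hcard, hsum] at h
  refine h.trans_eq ?_
  ring
end
end
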